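/- arXiv:0707.4522 — 4 statements merged into one kernel-verified Lean document; each statement's English description precedes it below -/
import Mathlib

section
/- Let G be a group and let K ≤ L ≤ G be subgroups with K^{(1)}_r ≤ L. Then the normal cores satisfy (Core_G(K))^{(1)}_r ≤ Core_G(L), where Core_G(K) = ⋂_{g ∈ G} g K g^{-1}. -/
/-- The rational derived subgroup of a subgroup `H` of `G`, as a subset of `G`:
`{x ∈ H : x ^ k ∈ [H,H] for some nonzero integer k}`. -/
def ratDer {G : Type*} [Group G] (H : Subgroup G) : Set G :=
  {x : G | x ∈ H ∧ ∃ k : ℤ, k ≠ 0 ∧ x ^ k ∈ ⁅H, H⁆}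

/-- The normal core of a subgroup `K ≤ G`: `Core_G(K) = ⋂_{g ∈ G} g K g⁻¹`. -/
def core {G : Type*} [Group G] (K : Subgroup G) : Subgroup G :=
  ⨅ g : G, Subgroup.map (MulAut.conj g).toMonoidHom K

theorem core_eq_normalCore {G : Type*} [Group G] (K : Subgroup G) : core K = K.normalCore :=
  K.normalCore_eq_iInf_map_conj.symm

theorem ratDer_mono {G : Type*} [Group G] {H K : Subgroup G} (hHK : H ≤ K) :
    ratDer H ⊆ ratDer K := by
  rintro x ⟨hx, k, hk, hxk⟩
  exact ⟨hHK hx, k, hk, Subgroup.commutator_mono hHK hHK hxk⟩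

theorem conj_mem_ratDer {G : Type*} [Group G] {N : Subgroup G} [hN : N.Normal] {x : G}
    (hx : x ∈ ratDer N) (g : G) : g * x * g⁻¹ ∈ ratDer N := by
  obtain ⟨hxN, k, hk, hxk⟩ := hx
  refine ⟨hN.conj_mem x hxN g, k, hk, ?_⟩
  rw [conj_zpow]
  exact (Subgroup.commutator_normal N N).conj_mem _ hxk g

/-- The inclusion of the rational derived subgroup of `core K` in `core L` only needs
`ratDer K ⊆ L`, not `K ≤ L`. -/
theorem ratDer_core_subset_core {G : Type*} [Group G] {K L : Subgroup G}
    (h : ratDer K ⊆ (L : Set G)) : ratDer (core K) ⊆ (core L : Set G) := by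
  rw [core_eq_normalCore, core_eq_normalCore]
  exact fun x hx g => h (ratDer_mono K.normalCore_le (conj_mem_ratDer hx g))

/-- If `K ≤ L ≤ G` are subgroups with `K⁽¹⁾ᵣ ≤ L`, then the normal cores satisfy
`(Core_G(K))⁽¹⁾ᵣ ≤ Core_G(L)`. -/
theorem ratDer_core_le_core {G : Type*} [Group G] (K L : Subgroup G)
    (hKL : K ≤ L) (h : ratDer K ⊆ (L : Set G)) :
    ratDer (core K) ⊆ (core L : Set G) := by
  exact ratDer_core_subset_core h
end

section
/- A finitely generated right-angled Coxeter group G has a finite-index subgroup G' such that G' is RFRS. -/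
/-- `Gs` witnesses the RFRS condition: `Gs 0 = G`, each `Gs i` is a finite-index normal
subgroup of `G`, the sequence is descending, `⋂ i, Gs i = {1}`, and
`(Gs i)⁽¹⁾ᵣ ≤ Gs (i+1)` for every `i`. -/
def RFRSWitness {G : Type*} [Group G] (Gs : ℕ → Subgroup G) : Prop :=
  Gs 0 = ⊤ ∧ (∀ i, (Gs i).Normal) ∧ (∀ i, (Gs i).FiniteIndex) ∧
  (∀ i, Gs (i + 1) ≤ Gs i) ∧ (⨅ i, Gs i) = ⊥ ∧
  ∀ i, ratDer (Gs i) ⊆ (Gs (i + 1) : Set G)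

/-- A group is RFRS (residually finite rational solvable) if it admits an RFRS witness
sequence. -/
def IsRFRS (G : Type*) [Group G] : Prop := ∃ Gs : ℕ → Subgroup G, RFRSWitness Gs

/-- A Coxeter matrix is right-angled if all off-diagonal entries are `2` or `0`
(where `0` encodes infinite order). -/
def CoxeterMatrix.IsRightAngled {B : Type*} (M : CoxeterMatrix B) : Prop :=
  ∀ s t : B, s ≠ t → M s t = 2 ∨ M s t = 0

section EvenKernel

variable {Γ : Type*} [Group Γ]

/-- Reduction modulo `2` from the integers, written multiplicatively. -/
def intParity : Multiplicative ℤ →* Multiplicative (ZMod 2) :=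
  AddMonoidHom.toMultiplicative (Int.castAddHom (ZMod 2))

theorem intParity_eq_one_iff (x : Multiplicative ℤ) : intParity x = 1 ↔ Even x.toAdd :=
  ZMod.intCast_eq_zero_iff_even

/-- The elements of `H` on which every homomorphism from `H` to the integers is even. -/
def evenKernel (H : Subgroup Γ) : Subgroup Γ :=
  (⨅ φ : H →* Multiplicative ℤ, (intParity.comp φ).ker).map H.subtype

theorem mem_evenKernel {H : Subgroup Γ} {g : Γ} :
    g ∈ evenKernel H ↔ ∃ hg : g ∈ H, ∀ φ : H →* Multiplicative ℤ, Even (φ ⟨g, hg⟩).toAdd := by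
  simp [evenKernel, Subgroup.mem_iInf, MonoidHom.mem_ker, intParity_eq_one_iff]

theorem evenKernel_le (H : Subgroup Γ) : evenKernel H ≤ H :=
  Subgroup.map_subtype_le _

theorem evenKernel_normal {H : Subgroup Γ} (hH : H.Normal) : (evenKernel H).Normal := by
  refine ⟨fun h hh g => ?_⟩
  obtain ⟨hm, he⟩ := mem_evenKernel.1 hh
  refine mem_evenKernel.2 ⟨hH.conj_mem h hm g, fun φ => ?_⟩
  exact he (φ.comp (MulAut.conjNormal g : H ≃* H).toMonoidHom)

theorem finite_monoidHom_of_fg (G A : Type*) [Group G] [Group A] [Group.FG G] [Finite A] :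
    Finite (G →* A) := by
  obtain ⟨S, hS⟩ := Group.fg_iff.1 ‹Group.FG G›
  have : Finite S := hS.2
  refine Finite.of_injective (fun (f : G →* A) (s : S) => f s) fun f g hfg => ?_
  exact MonoidHom.eq_of_eqOn_dense hS.1 fun s hs => congrFun hfg ⟨s, hs⟩

theorem evenKernel_finiteIndex [Group.FG Γ] {H : Subgroup Γ} (hH : H.FiniteIndex) :
    (evenKernel H).FiniteIndex := by
  have : Group.FG H := Subgroup.fg_of_index_ne_zero H
  have := finite_monoidHom_of_fg H (Multiplicative (ZMod 2))
  have h₁ : (⨅ ψ : H →* Multiplicative (ZMod 2), ψ.ker).FiniteIndex :=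
    Subgroup.finiteIndex_iInf fun ψ => inferInstance
  have h₂ : (⨅ φ : H →* Multiplicative ℤ, (intParity.comp φ).ker).FiniteIndex :=
    Subgroup.finiteIndex_of_le (le_iInf fun φ => iInf_le _ (intParity.comp φ))
  refine ⟨?_⟩
  rw [evenKernel, Subgroup.index_map_subtype]
  exact mul_ne_zero h₂.index_ne_zero hH.index_ne_zero

theorem map_eq_one_of_mem_commutator {A : Type*} [CommGroup A] {H : Subgroup Γ} (φ : H →* A)
    {g : Γ} (hg : g ∈ H) (hc : g ∈ ⁅H, H⁆) : φ ⟨g, hg⟩ = 1 := by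
  rw [← Subgroup.map_subtype_commutator] at hc
  obtain ⟨x, hx, rfl⟩ := hc
  exact Abelianization.commutator_subset_ker φ hx

theorem ratDer_subset_evenKernel (H : Subgroup Γ) : ratDer H ⊆ (evenKernel H : Set Γ) := by
  rintro g ⟨hg, k, hk, hc⟩
  refine mem_evenKernel.2 ⟨hg, fun φ => ?_⟩
  have h := map_eq_one_of_mem_commutator φ (H.zpow_mem hg k) hc
  have h' : φ ⟨g, hg⟩ ^ k = 1 := by rw [← map_zpow]; exact h
  have h'' : k * (φ ⟨g, hg⟩).toAdd = 0 := by
    simpa using congrArg Multiplicative.toAdd h'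
  simp [(mul_eq_zero.1 h'').resolve_left hk]

/-- The iterated even kernels of a group. -/
def evenTower (Γ : Type*) [Group Γ] : ℕ → Subgroup Γ
  | 0 => ⊤
  | n + 1 => evenKernel (evenTower Γ n)

theorem isRFRS_of_evenTower [Group.FG Γ] (h : ∀ g : Γ, (∀ n, g ∈ evenTower Γ n) → g = 1) :
    IsRFRS Γ := by
  refine ⟨evenTower Γ, rfl, fun n => ?_, fun n => ?_, fun n => evenKernel_le _, ?_,
    fun n => ratDer_subset_evenKernel _⟩
  · induction n with
    | zero => exact inferInstanceAs (⊤ : Subgroup Γ).Normal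
    | succ n ih => exact evenKernel_normal ih
  · induction n with
    | zero => exact inferInstanceAs (⊤ : Subgroup Γ).FiniteIndex
    | succ n ih => exact evenKernel_finiteIndex ih
  · exact (Subgroup.eq_bot_iff_forall _).2 fun g hg => h g (Subgroup.mem_iInf.1 hg)

end EvenKernel

namespace CoxeterMatrix

variable {B : Type*} {M : CoxeterMatrix B}

theorem simple_mul_self (i : B) : M.simple i * M.simple i = 1 :=
  M.toCoxeterSystem.simple_mul_simple_self i

theorem mul_simple_cancel (w : M.Group) (i : B) : w * M.simple i * M.simple i = w := by
  rw [mul_assoc, simple_mul_self, mul_one]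

theorem simple_inv (i : B) : (M.simple i)⁻¹ = M.simple i :=
  M.toCoxeterSystem.inv_simple i

theorem simple_commute {i j : B} (h : M i j = 2) :
    M.simple i * M.simple j = M.simple j * M.simple i := by
  have h₁ := M.toCoxeterSystem.simple_mul_simple_pow i j
  rw [h, pow_two, toCoxeterSystem_simple] at h₁
  simpa [simple_inv] using eq_inv_of_mul_eq_one_left h₁

theorem IsRightAngled.isLiftable (hM : M.IsRightAngled) {G : Type*} [Group G] {f : B → G}
    (h₁ : ∀ i, f i * f i = 1) (h₂ : ∀ i j, M i j = 2 → f i * f j = f j * f i) :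
    M.IsLiftable f := by
  intro i j
  by_cases hij : i = j
  · subst hij
    simp [h₁]
  · rcases hM i j hij with h | h
    · rw [h, pow_two]
      nth_rw 2 [h₂ i j h]
      rw [mul_assoc, ← mul_assoc (f j), h₁, one_mul, h₁]
    · simp [h]

/-- The subgroup generated by `a` and the generators commuting with `a`; its left cosets are the
walls of type `a`. -/
def wallStabilizer (M : CoxeterMatrix B) (a : B) : Subgroup M.Group :=
  Subgroup.closure {x | ∃ i, M a i ≠ 0 ∧ x = M.simple i}

theorem simple_mem_wallStabilizer {a i : B} (h : M a i ≠ 0) :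
    M.simple i ∈ M.wallStabilizer a :=
  Subgroup.subset_closure ⟨i, h, rfl⟩

theorem IsRightAngled.simple_conj (hM : M.IsRightAngled) {a i : B} (h : M a i ≠ 0) :
    M.simple i * M.simple a * M.simple i = M.simple a := by
  by_cases hai : a = i
  · subst hai
    rw [mul_simple_cancel]
  · rw [← simple_commute ((hM a i hai).resolve_right h), mul_simple_cancel]

open Classical in
/-- The character of a right-angled Coxeter group that is `-1` on the generator `a` and trivial
on the other generators. -/
noncomputable def IsRightAngled.sign (hM : M.IsRightAngled) (a : B) : M.Group →* ℤˣ :=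
  M.toCoxeterSystem.lift ⟨fun i => if i = a then -1 else 1,
    hM.isLiftable (fun i => by split_ifs <;> simp) (fun i j _ => mul_comm _ _)⟩

open Classical in
theorem IsRightAngled.sign_simple (hM : M.IsRightAngled) (a i : B) :
    hM.sign a (M.simple i) = if i = a then -1 else 1 :=
  M.toCoxeterSystem.lift_apply_simple _ i

/-- The common kernel of the sign characters. -/
noncomputable def IsRightAngled.signKernel (hM : M.IsRightAngled) : Subgroup M.Group :=
  ⨅ a, (hM.sign a).ker

theorem IsRightAngled.sign_eq_one (hM : M.IsRightAngled) {g : M.Group} (hg : g ∈ hM.signKernel)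
    (a : B) : hM.sign a g = 1 :=
  Subgroup.mem_iInf.1 hg a

open Classical in
/-- The signed contribution of the edge from `w` to `w * s i` when crossings of the walls of
type `a` lying in `D` are counted. -/
noncomputable def IsRightAngled.crossing (hM : M.IsRightAngled) (a : B) (D : Set M.Group)
    (i : B) (w : M.Group) : ℤ :=
  if i = a ∧ w ∈ D then (hM.sign a w : ℤ) else 0

theorem IsRightAngled.crossing_mul_simple_self (hM : M.IsRightAngled) {a : B} {D : Set M.Group}
    (hD : ∀ w, ∀ c ∈ M.wallStabilizer a, w * c ∈ D ↔ w ∈ D) (i : B) (w : M.Group) :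
    hM.crossing a D i (w * M.simple i) = -hM.crossing a D i w := by
  unfold IsRightAngled.crossing
  by_cases hi : i = a
  · subst hi
    rw [hD w _ (simple_mem_wallStabilizer (by simp)), map_mul, hM.sign_simple, if_pos rfl]
    split_ifs <;> simp
  · simp [hi]

theorem IsRightAngled.crossing_mul_simple (hM : M.IsRightAngled) {a : B} {D : Set M.Group}
    (hD : ∀ w, ∀ c ∈ M.wallStabilizer a, w * c ∈ D ↔ w ∈ D) {i j : B} (hij : M i j = 2)
    (w : M.Group) : hM.crossing a D i (w * M.simple j) = hM.crossing a D i w := by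
  unfold IsRightAngled.crossing
  by_cases hi : i = a
  · subst hi
    have hji : j ≠ i := by
      rintro rfl
      simp at hij
    rw [hD w _ (simple_mem_wallStabilizer (by simp [hij])), map_mul, hM.sign_simple, if_neg hji,
      mul_one]
  · simp [hi]

theorem IsRightAngled.exists_wallCount (hM : M.IsRightAngled) {a : B} {D : Set M.Group}
    (hD : ∀ w, ∀ c ∈ M.wallStabilizer a, w * c ∈ D ↔ w ∈ D) :
    ∃ φ : M.Group → ℤ, φ 1 = 0 ∧
      ∀ w i, φ (w * M.simple i) = φ w + hM.crossing a D i w := by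
  let f (i : B) : Equiv.Perm (M.Group × ℤ) :=
    Function.Involutive.toPerm (fun x => (x.1 * M.simple i, x.2 + hM.crossing a D i x.1))
      fun x => by
        ext
        · exact mul_simple_cancel _ _
        · simp [hM.crossing_mul_simple_self hD]
  have hf (i : B) (x : M.Group × ℤ) :
      f i x = (x.1 * M.simple i, x.2 + hM.crossing a D i x.1) := rfl
  have hl : M.IsLiftable f := by
    refine hM.isLiftable (fun i => ?_) fun i j hij => ?_
    · ext x : 1
      exact Function.Involutive.toPerm_involutive _ x
    · ext x : 1
      have hji : M j i = 2 := by rw [M.symmetric, hij]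
      simp only [Equiv.Perm.mul_apply, hf, mul_assoc, simple_commute hij,
        hM.crossing_mul_simple hD hij, hM.crossing_mul_simple hD hji, add_assoc,
        add_comm (hM.crossing a D i x.1)]
  let ρ : M.Group →* Equiv.Perm (M.Group × ℤ) := M.toCoxeterSystem.lift ⟨f, hl⟩
  have hρ (i : B) : ρ (M.simple i) = f i := M.toCoxeterSystem.lift_apply_simple hl i
  have hstep (w : M.Group) (i : B) :
      ρ (w * M.simple i)⁻¹ (1, 0) = f i (ρ w⁻¹ (1, 0)) := by
    rw [mul_inv_rev, simple_inv, map_mul, hρ, Equiv.Perm.mul_apply]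
  have hfst (w : M.Group) : (ρ w⁻¹ (1, 0)).1 = w := by
    induction w using M.toCoxeterSystem.simple_induction_right with
    | one => simp
    | mul_simple_right w i ih => rw [toCoxeterSystem_simple, hstep, hf, ih]
  refine ⟨fun w => (ρ w⁻¹ (1, 0)).2, by simp, fun w i => ?_⟩
  simp only [hstep, hf, hfst]

theorem IsRightAngled.wallCount_mul (hM : M.IsRightAngled) {a : B} {D : Set M.Group}
    {φ : M.Group → ℤ} (h₁ : φ 1 = 0)
    (hφ : ∀ w i, φ (w * M.simple i) = φ w + hM.crossing a D i w) {g : M.Group}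
    (hg : g ∈ hM.signKernel) (hgD : ∀ w, g * w ∈ D ↔ w ∈ D) (w : M.Group) :
    φ (g * w) = φ g + φ w := by
  induction w using M.toCoxeterSystem.simple_induction_right with
  | one => simp [h₁]
  | mul_simple_right w i ih =>
    have : hM.crossing a D i (g * w) = hM.crossing a D i w := by
      simp only [IsRightAngled.crossing, map_mul, hM.sign_eq_one hg, one_mul]
      congr 1
      rw [hgD]
    rw [toCoxeterSystem_simple, ← mul_assoc, hφ, hφ, ih, this, add_assoc]

theorem IsRightAngled.even_crossing_iff (hM : M.IsRightAngled) {a : B} {D : Set M.Group} {i : B}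
    {w : M.Group} : Even (hM.crossing a D i w) ↔ ¬(i = a ∧ w ∈ D) := by
  unfold IsRightAngled.crossing
  split_ifs with h
  · rcases Int.units_eq_one_or (hM.sign a w) with h' | h' <;> simp [h, h']
  · simp [h]

theorem IsRightAngled.even_wallCount_mul (hM : M.IsRightAngled) {a : B} {D : Set M.Group}
    {φ : M.Group → ℤ} (h₁ : φ 1 = 0)
    (hφ : ∀ w i, φ (w * M.simple i) = φ w + hM.crossing a D i w) {g : M.Group}
    (hgD : ∀ w, g * w ∈ D ↔ w ∈ D) (w : M.Group) :
    Even (φ (g * w)) ↔ (Even (φ g) ↔ Even (φ w)) := by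
  induction w using M.toCoxeterSystem.simple_induction_right with
  | one => simp [h₁]
  | mul_simple_right w i ih =>
    rw [toCoxeterSystem_simple, ← mul_assoc, hφ, hφ, Int.even_add, Int.even_add, ih,
      hM.even_crossing_iff, hM.even_crossing_iff, hgD]
    tauto

/-- `P` is a set of chambers that meets no `R`-orbit twice, and `R` contains the reflection in
every wall bounding `P`. -/
structure IsReflectionDomain (P : Set M.Group) (R : Subgroup M.Group) : Prop where
  one_mem : 1 ∈ P
  eq_one : ∀ p ∈ P, ∀ q ∈ P, ∀ r ∈ R, r * p = q → r = 1
  reflection_mem : ∀ p ∈ P, ∀ i, p * M.simple i ∉ P → p * M.simple i * p⁻¹ ∈ R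

theorem IsReflectionDomain.reflection_eq (hM : M.IsRightAngled) {P : Set M.Group}
    {R : Subgroup M.Group} (h : IsReflectionDomain P R) {a : B} {p q r c : M.Group} (hp : p ∈ P)
    (hq : q ∈ P) (hr : r ∈ R) (hc : c ∈ M.wallStabilizer a) (heq : p * c = r * q) :
    q * M.simple a * q⁻¹ = p * M.simple a * p⁻¹ := by
  have key (i : B) (hi : M a i ≠ 0) (x : M.Group)
      (ih : ∃ r ∈ R, ∃ q ∈ P, p * x = r * q ∧ q * M.simple a * q⁻¹ = p * M.simple a * p⁻¹) :
      ∃ r ∈ R, ∃ q ∈ P, p * (x * M.simple i) = r * q ∧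
        q * M.simple a * q⁻¹ = p * M.simple a * p⁻¹ := by
    obtain ⟨r, hr, q, hq, h₁, h₂⟩ := ih
    by_cases hqi : q * M.simple i ∈ P
    · refine ⟨r, hr, _, hqi, by rw [← mul_assoc, h₁, mul_assoc], ?_⟩
      rw [← h₂, mul_inv_rev, simple_inv]
      nth_rw 2 [← hM.simple_conj hi]
      simp only [mul_assoc]
    · refine ⟨_, R.mul_mem hr (h.reflection_mem q hq i hqi), q, hq, ?_, h₂⟩
      rw [← mul_assoc, h₁]
      group
  have walk : ∃ r ∈ R, ∃ q ∈ P, p * c = r * q ∧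
      q * M.simple a * q⁻¹ = p * M.simple a * p⁻¹ := by
    clear heq
    induction hc using Subgroup.closure_induction_right with
    | one => exact ⟨1, R.one_mem, p, hp, by simp, rfl⟩
    | mul_right x _ y hy ih =>
      obtain ⟨i, hi, rfl⟩ := hy
      exact key i hi x ih
    | mul_inv_cancel x _ y hy ih =>
      obtain ⟨i, hi, rfl⟩ := hy
      rw [simple_inv]
      exact key i hi x ih
  obtain ⟨r', hr', q', hq', h₁, h₂⟩ := walk
  rw [heq] at h₁
  have h₃ : r'⁻¹ * r * q = q' := by rw [mul_assoc, h₁, inv_mul_cancel_left]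
  have h₄ := h.eq_one q hq q' hq' _ (R.mul_mem (R.inv_mem hr') hr) h₃
  rw [h₄, one_mul] at h₃
  rw [h₃, h₂]

/-- Doubling a reflection domain across a bounding wall gives a reflection domain for a subgroup
containing the even kernel of every subgroup of `R` in the sign kernel. -/
theorem IsReflectionDomain.exists_double (hM : M.IsRightAngled) {P : Set M.Group}
    {R : Subgroup M.Group} (h : IsReflectionDomain P R) {p : M.Group} (hp : p ∈ P) {a : B}
    (ha : p * M.simple a ∉ P) :
    ∃ (P' : Set M.Group) (R' : Subgroup M.Group), IsReflectionDomain P' R' ∧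
      p * M.simple a ∈ P' ∧
      ∀ H : Subgroup hM.signKernel, H.map hM.signKernel.subtype ≤ R →
        (evenKernel H).map hM.signKernel.subtype ≤ R' := by
  obtain ⟨t, ht⟩ : ∃ t, t = p * M.simple a * p⁻¹ := ⟨_, rfl⟩
  have htR : t ∈ R := ht ▸ h.reflection_mem p hp a ha
  have htt : t * t = 1 := by
    rw [ht, ← mul_assoc, ← mul_assoc, inv_mul_cancel_right, mul_simple_cancel, mul_inv_cancel]
  let D : Set M.Group := {w | ∃ r ∈ R, ∃ c ∈ M.wallStabilizer a, w = r * p * c}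
  have hD (w c) (hc : c ∈ M.wallStabilizer a) : w * c ∈ D ↔ w ∈ D := by
    constructor
    · rintro ⟨r, hr, d, hd, e⟩
      exact ⟨r, hr, d * c⁻¹, mul_mem hd (inv_mem hc), by rw [← mul_assoc, ← e]; group⟩
    · rintro ⟨r, hr, d, hd, rfl⟩
      exact ⟨r, hr, d * c, mul_mem hd hc, by group⟩
  have hRD (r) (hr : r ∈ R) (w) : r * w ∈ D ↔ w ∈ D := by
    constructor
    · rintro ⟨r', hr', d, hd, e⟩
      refine ⟨r⁻¹ * r', mul_mem (inv_mem hr) hr', d, hd, ?_⟩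
      rw [mul_assoc, mul_assoc, ← mul_assoc r', ← e, inv_mul_cancel_left]
    · rintro ⟨r', hr', d, hd, rfl⟩
      exact ⟨r * r', mul_mem hr hr', d, hd, by group⟩
  obtain ⟨φ, h₁, hφ⟩ := hM.exists_wallCount hD
  have hpar (r) (hr : r ∈ R) (w) := hM.even_wallCount_mul h₁ hφ (hRD r hr) w
  have hrefl (q : M.Group) (i : B) (hq : q * M.simple i * q⁻¹ ∈ R) :
      Even (φ (q * M.simple i * q⁻¹)) ↔ ¬(i = a ∧ q ∈ D) := by
    have := hpar _ hq q
    rw [inv_mul_cancel_right, hφ, Int.even_add, hM.even_crossing_iff] at this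
    tauto
  have htodd : ¬Even (φ t) := by
    rw [ht, hrefl p a (ht ▸ htR), not_not]
    exact ⟨rfl, 1, R.one_mem, 1, Subgroup.one_mem _, by simp⟩
  let R' : Subgroup M.Group :=
    { carrier := {r | r ∈ R ∧ Even (φ r)}
      one_mem' := ⟨R.one_mem, by simp [h₁]⟩
      mul_mem' := fun {x y} hx hy => ⟨mul_mem hx.1 hy.1, (hpar x hx.1 y).2 (by simp [hx.2, hy.2])⟩
      inv_mem' := fun {x} hx => ⟨inv_mem hx.1, by
        have := hpar x hx.1 x⁻¹
        rw [mul_inv_cancel, h₁] at this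
        simpa [hx.2] using this⟩ }
  have hR' {r : M.Group} : r ∈ R' ↔ r ∈ R ∧ Even (φ r) := Iff.rfl
  have htinv : t⁻¹ = t := inv_eq_of_mul_eq_one_right htt
  have hmem (q : M.Group) : q ∈ P ∪ (fun w => t * w) ⁻¹' P ↔ q ∈ P ∨ t * q ∈ P := Iff.rfl
  have htcancel (w : M.Group) : t * (t * w) = w := by rw [← mul_assoc, htt, one_mul]
  have hbound (q : M.Group) (hq : q ∈ P) (i : B) (hqi : q * M.simple i ∉ P)
      (htqi : t * (q * M.simple i) ∉ P) : q * M.simple i * q⁻¹ ∈ R' := by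
    have hu := h.reflection_mem q hq i hqi
    refine hR'.2 ⟨hu, (hrefl q i hu).2 ?_⟩
    rintro ⟨rfl, r, hr, c, hc, e⟩
    have hpq := h.reflection_eq hM hq hp hr (inv_mem hc) (a := i) (by rw [e]; group)
    apply htqi
    rw [ht, hpq]
    have : q * M.simple i * q⁻¹ * (q * M.simple i) = q := by
      rw [← mul_assoc, inv_mul_cancel_right, mul_simple_cancel]
    rwa [this]
  refine ⟨P ∪ (fun w => t * w) ⁻¹' P, R', ⟨Or.inl h.one_mem, ?_, ?_⟩, Or.inr ?_, ?_⟩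
  · rintro q (hq | hq) q' (hq' | hq') r ⟨hr, he⟩ e
    · exact h.eq_one q hq q' hq' r hr e
    · have := h.eq_one q hq _ hq' (t * r) (mul_mem htR hr) (by rw [mul_assoc, e])
      rw [← inv_eq_iff_mul_eq_one, htinv] at this
      exact absurd (this ▸ he) htodd
    · have := h.eq_one _ hq q' hq' (r * t) (mul_mem hr htR) (by rw [mul_assoc, htcancel, e])
      rw [mul_eq_one_iff_eq_inv, htinv] at this
      exact absurd (this ▸ he) htodd
    · have := h.eq_one _ hq _ hq' (t * r * t) (mul_mem (mul_mem htR hr) htR)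
        (by rw [mul_assoc, htcancel, mul_assoc, e])
      rw [mul_eq_one_iff_eq_inv, htinv] at this
      simpa using this
  · rintro q (hq | hq) i hqi
    · rw [hmem, not_or] at hqi
      exact hbound q hq i hqi.1 hqi.2
    · rw [hmem, not_or] at hqi
      have hu := hbound (t * q) hq i (by rw [mul_assoc]; exact hqi.2)
        (by rw [mul_assoc, htcancel]; exact hqi.1)
      have e : q * M.simple i * q⁻¹ = t * ((t * q * M.simple i * (t * q)⁻¹) * t) := by
        rw [mul_inv_rev, htinv]
        simp only [mul_assoc, htcancel, htt, mul_one]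
      obtain ⟨huR, hue⟩ := hu
      rw [e]
      refine ⟨mul_mem htR (mul_mem huR htR), ?_⟩
      rw [hpar _ htR, hpar _ huR]
      tauto
  · have : t * (p * M.simple a) = p := by
      rw [ht, ← mul_assoc, inv_mul_cancel_right, mul_simple_cancel]
    simpa [this] using hp
  · rintro H hH _ ⟨g, hg, rfl⟩
    obtain ⟨hgH, hge⟩ := mem_evenKernel.1 hg
    have hHR (x : H) : ((x : hM.signKernel) : M.Group) ∈ R := hH ⟨x, x.2, rfl⟩
    let ψ : H →* Multiplicative ℤ :=
      { toFun := fun x => Multiplicative.ofAdd (φ ((x : hM.signKernel) : M.Group))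
        map_one' := by simp [h₁]
        map_mul' := fun x y => by
          rw [← ofAdd_add, ← hM.wallCount_mul h₁ hφ x.1.2 (hRD _ (hHR x))]
          rfl }
    exact ⟨hHR ⟨g, hgH⟩, hge ψ⟩

theorem IsRightAngled.exists_isReflectionDomain (hM : M.IsRightAngled) (w : M.Group) :
    ∃ (P : Set M.Group) (R : Subgroup M.Group) (n : ℕ), IsReflectionDomain P R ∧ w ∈ P ∧
      (evenTower hM.signKernel n).map hM.signKernel.subtype ≤ R := by
  induction w using M.toCoxeterSystem.simple_induction_right with
  | one =>
    exact ⟨{1}, ⊤, 0, ⟨rfl, by rintro _ rfl _ rfl r - e; simpa using e,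
      fun _ _ _ _ => Subgroup.mem_top _⟩, rfl, le_top⟩
  | mul_simple_right w i ih =>
    obtain ⟨P, R, n, h, hw, hn⟩ := ih
    rw [toCoxeterSystem_simple]
    by_cases hwi : w * M.simple i ∈ P
    · exact ⟨P, R, n, h, hwi, hn⟩
    · obtain ⟨P', R', h', hw', hH⟩ := h.exists_double hM hw hwi
      exact ⟨P', R', n + 1, h', hw', hH _ hn⟩

theorem IsRightAngled.eq_one_of_mem_evenTower (hM : M.IsRightAngled) (g : hM.signKernel)
    (hg : ∀ n, g ∈ evenTower hM.signKernel n) : g = 1 := by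
  obtain ⟨P, R, n, h, hgP, hn⟩ := hM.exists_isReflectionDomain (g : M.Group)
  exact Subtype.ext (h.eq_one 1 h.one_mem _ hgP _ (hn ⟨g, hg n, rfl⟩) (mul_one _))

theorem group_fg [Finite B] (M : CoxeterMatrix B) : Group.FG M.Group :=
  Group.fg_iff.2 ⟨_, M.toCoxeterSystem.subgroup_closure_range_simple, Set.finite_range _⟩

theorem IsRightAngled.signKernel_finiteIndex [Finite B] (hM : M.IsRightAngled) :
    hM.signKernel.FiniteIndex :=
  Subgroup.finiteIndex_iInf fun _ => inferInstance

end CoxeterMatrix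

/-- A finitely generated right-angled Coxeter group has a finite-index subgroup which
is RFRS. -/
theorem rightAngledCoxeter_virtually_RFRS {B : Type*} [Finite B] (M : CoxeterMatrix B)
    (hM : M.IsRightAngled) :
    ∃ G' : Subgroup M.Group, G'.FiniteIndex ∧ IsRFRS G' := by
  have := M.group_fg
  have := hM.signKernel_finiteIndex
  have : Group.FG hM.signKernel := Subgroup.fg_of_index_ne_zero _
  exact ⟨hM.signKernel, ‹_›, isRFRS_of_evenTower hM.eq_one_of_mem_evenTower⟩
end

section
/- Every Coxeter group on a finite generating set is virtually RFRS, i.e., it has a finite-index subgroup that is RFRS. -/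
/-- Data of an abstract root system for a Coxeter system: an action of `W` on `V`, simple roots,
and a notion of positivity on the orbits of the simple roots. -/
structure RootData {B W : Type*} [Group W] {M : CoxeterMatrix B} (cs : CoxeterSystem M W)
    (V : Type*) [AddCommGroup V] [DistribMulAction W V] where
  root : B → V
  pos : V → Prop
  pos_root : ∀ b, pos (root b)
  pos_or : ∀ (w : W) b, pos (w • root b) ∨ pos (-(w • root b))
  not_pos_neg : ∀ (w : W) b, pos (w • root b) → ¬ pos (-(w • root b))
  simple_smul_root : ∀ b, cs.simple b • root b = -root b
  pos_simple_smul : ∀ (w : W) b c, pos (w • root b) → w • root b ≠ root c →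
    pos (cs.simple c • w • root b)
  reflection_eq : ∀ (w : W) b (v : W) c, w • root b = v • root c →
    w * cs.simple b * w⁻¹ = v * cs.simple c * v⁻¹

namespace RootData

open Pointwise

variable {B W : Type*} [Group W] {M : CoxeterMatrix B} {cs : CoxeterSystem M W}
  {V : Type*} [AddCommGroup V] [DistribMulAction W V] (Φ : RootData cs V)

local prefix:100 "σ" => cs.simple
local prefix:100 "π" => cs.wordProd

/-- The roots: the orbits of the simple roots. -/
def IsRoot (β : V) : Prop := ∃ (w : W) (b : B), β = w • Φ.root b

variable {Φ}

theorem isRoot_smul {β : V} (h : Φ.IsRoot β) (w : W) : Φ.IsRoot (w • β) := by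
  obtain ⟨v, b, rfl⟩ := h
  exact ⟨w * v, b, (mul_smul _ _ _).symm⟩

theorem isRoot_smul_iff {β : V} (w : W) : Φ.IsRoot (w • β) ↔ Φ.IsRoot β :=
  ⟨fun h => by simpa using isRoot_smul h w⁻¹, fun h => isRoot_smul h w⟩

theorem isRoot_root (b : B) : Φ.IsRoot (Φ.root b) := ⟨1, b, (one_smul _ _).symm⟩

theorem neg_smul_root (w : W) (b : B) : -(w • Φ.root b) = (w * σ b) • Φ.root b := by
  rw [mul_smul, Φ.simple_smul_root, smul_neg]

theorem IsRoot.neg {β : V} (h : Φ.IsRoot β) : Φ.IsRoot (-β) := by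
  obtain ⟨v, b, rfl⟩ := h
  exact ⟨v * σ b, b, neg_smul_root v b⟩

theorem IsRoot.not_pos_iff {β : V} (h : Φ.IsRoot β) : ¬ Φ.pos β ↔ Φ.pos (-β) := by
  obtain ⟨w, b, rfl⟩ := h
  exact ⟨(Φ.pos_or w b).resolve_left, fun h h' => Φ.not_pos_neg w b h' h⟩

theorem IsRoot.not_pos_neg_iff {β : V} (h : Φ.IsRoot β) : ¬ Φ.pos (-β) ↔ Φ.pos β := by
  rw [h.neg.not_pos_iff, neg_neg]

/-- A simple reflection preserves the sign of all roots other than plus or minus its root. -/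
theorem IsRoot.pos_simple_smul_iff {β : V} (h : Φ.IsRoot β) {c : B} (h1 : β ≠ Φ.root c)
    (h2 : β ≠ -Φ.root c) : Φ.pos (σ c • β) ↔ Φ.pos β := by
  constructor
  · intro h3
    by_contra h4
    rw [h.not_pos_iff] at h4
    obtain ⟨w, b, hw⟩ := h.neg
    have h5 := Φ.pos_simple_smul w b c (hw ▸ h4) (by
      rw [← hw]; intro h; exact h2 (by rw [← h, neg_neg]))
    rw [← hw, smul_neg] at h5
    exact ((isRoot_smul h (σ c)).not_pos_iff.2 h5) h3
  · intro h3
    obtain ⟨w, b, rfl⟩ := h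
    exact Φ.pos_simple_smul w b c h3 h1

theorem reflection_eq_of_neg {w v : W} {b c : B} (h : w • Φ.root b = -(v • Φ.root c)) :
    w * σ b * w⁻¹ = v * σ c * v⁻¹ := by
  rw [neg_smul_root] at h
  rw [Φ.reflection_eq _ _ _ _ h]
  simp [mul_assoc]

variable (Φ) in
open Classical in
/-- The sign change of `β` under `w⁻¹`, as an integer. -/
noncomputable def signChange (w : W) (β : V) : ℤ :=
  if Φ.IsRoot β then (if Φ.pos β then 1 else 0) - (if Φ.pos (w⁻¹ • β) then 1 else 0) else 0

theorem signChange_one (β : V) : Φ.signChange 1 β = 0 := by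
  unfold signChange
  rw [inv_one, one_smul, sub_self, ite_self]

theorem signChange_mul (x y : W) (β : V) :
    Φ.signChange (x * y) β = Φ.signChange x β + Φ.signChange y (x⁻¹ • β) := by
  unfold signChange
  rw [isRoot_smul_iff]
  split_ifs <;> simp_all [mul_smul]

theorem signChange_neg (w : W) (β : V) : Φ.signChange w (-β) = -Φ.signChange w β := by
  unfold signChange
  have h0 : Φ.IsRoot (-β) ↔ Φ.IsRoot β := ⟨fun h => by simpa using h.neg, fun h => h.neg⟩
  rw [h0]
  by_cases h : Φ.IsRoot β
  · have h1 := h.not_pos_iff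
    have h2 := (isRoot_smul h w⁻¹).not_pos_iff
    rw [smul_neg, ← h1, ← h2]
    simp only [h, if_true]
    split_ifs <;> simp_all
  · simp [h]

theorem signChange_simple_ne_zero {b : B} {β : V} (h : Φ.signChange (σ b) β ≠ 0) :
    β = Φ.root b ∨ β = -Φ.root b := by
  by_contra! h'
  apply h
  unfold signChange
  split_ifs with h0 h1 h2 h2 <;> try rfl
  · exact absurd ((h0.pos_simple_smul_iff h'.1 h'.2).2 h1) (by simpa using h2)
  · exact absurd ((h0.pos_simple_smul_iff h'.1 h'.2).1 (by simpa using h2)) h1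

theorem root_ne_neg (b : B) : Φ.root b ≠ -Φ.root b := by
  intro h
  have := (isRoot_root (Φ := Φ) b).not_pos_neg_iff.2 (Φ.pos_root b)
  rw [← h] at this
  exact this (Φ.pos_root b)

theorem signChange_simple_root (b : B) : Φ.signChange (σ b) (Φ.root b) = 1 := by
  have := (isRoot_root (Φ := Φ) b).not_pos_neg_iff.2 (Φ.pos_root b)
  simp [signChange, isRoot_root, Φ.pos_root, Φ.simple_smul_root, this]

theorem signChange_finite (w : W) : (Function.support (Φ.signChange w)).Finite := by
  induction w using cs.simple_induction_left with
  | one => 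
    have : Φ.signChange 1 = 0 := funext signChange_one
    simp [this]
  | mul_simple_left w b ih =>
    have h1 : (Function.support (Φ.signChange (σ b))).Finite :=
      (Set.toFinite {Φ.root b, -Φ.root b}).subset fun β h => signChange_simple_ne_zero h
    refine (h1.union (ih.smul_set (a := σ b))).subset fun β hβ => ?_
    rw [Function.mem_support, signChange_mul] at hβ
    by_cases h2 : Φ.signChange (σ b) β = 0
    · right
      rw [Set.mem_smul_set_iff_inv_smul_mem]
      intro h3
      exact hβ (by rw [h2, h3, add_zero])
    · left; exact h2

variable (Φ) in
/-- The signed number of roots in `O` separating `1` from `w`. -/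
noncomputable def crossing (O : Set V) (w : W) : ℤ := ∑ᶠ β, O.indicator (Φ.signChange w) β

theorem indicator_finite (O : Set V) (w : W) :
    (Function.support (O.indicator (Φ.signChange w))).Finite :=
  (signChange_finite w).subset (by rw [Set.support_indicator]; exact Set.inter_subset_right)

theorem crossing_one (O : Set V) : Φ.crossing O 1 = 0 := by
  simp [crossing, Set.indicator, signChange_one]

theorem crossing_mul (O : Set V) (x y : W) :
    Φ.crossing O (x * y) = Φ.crossing O x + Φ.crossing {β | x • β ∈ O} y := by
  have : Φ.crossing {β | x • β ∈ O} y =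
      ∑ᶠ β, O.indicator (fun β => Φ.signChange y (x⁻¹ • β)) β := by
    unfold crossing
    rw [← finsum_comp_equiv (MulAction.toPerm x)
      (f := fun β => O.indicator (fun β => Φ.signChange y (x⁻¹ • β)) β)]
    refine finsum_congr fun β => ?_
    rw [MulAction.toPerm_apply]
    by_cases h : x • β ∈ O <;> simp [Set.indicator, h]
  rw [this]
  unfold crossing
  rw [← finsum_add_distrib (indicator_finite _ _)]
  · refine finsum_congr fun β => ?_
    by_cases h : β ∈ O <;> simp [h, signChange_mul]
  · refine ((signChange_finite (Φ := Φ) y).smul_set (a := x)).subset fun β hβ => ?_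
    rw [Set.mem_smul_set_iff_inv_smul_mem]
    intro h
    apply hβ
    simp [Set.indicator, h]

theorem crossing_simple (O : Set V) (b : B) [Decidable (Φ.root b ∈ O)]
    [Decidable (-Φ.root b ∈ O)] :
    Φ.crossing O (σ b) =
      (if Φ.root b ∈ O then 1 else 0) - (if -Φ.root b ∈ O then 1 else 0) := by
  classical
  unfold crossing
  rw [finsum_eq_sum_of_support_subset (s := {Φ.root b, -Φ.root b})]
  · rw [Finset.sum_pair (root_ne_neg b)]
    simp only [Set.indicator, signChange_neg, signChange_simple_root]
    split_ifs <;> simp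
  · intro β hβ
    have : Φ.signChange (σ b) β ≠ 0 := fun h => hβ (by simp [Set.indicator, h])
    simpa using signChange_simple_ne_zero this

theorem crossing_neg (O : Set V) (w : W) :
    Φ.crossing {β | -β ∈ O} w = -Φ.crossing O w := by
  unfold crossing
  rw [← finsum_comp_equiv (Equiv.neg V) (f := fun β => O.indicator (Φ.signChange w) β),
    ← finsum_neg_distrib]
  refine finsum_congr fun β => ?_
  by_cases h : -β ∈ O <;> simp [Set.indicator, signChange_neg, h]

theorem exists_of_crossing_ne_zero {O : Set V} {w : W} (h : Φ.crossing O w ≠ 0) :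
    ∃ β ∈ O, Φ.IsRoot β ∧ (Φ.pos β ↔ ¬ Φ.pos (w⁻¹ • β)) := by
  by_contra! h'
  apply h
  unfold crossing
  rw [← finsum_zero (α := V)]
  refine finsum_congr fun β => ?_
  by_cases hO : β ∈ O
  · rw [Set.indicator_of_mem hO]
    unfold signChange
    split_ifs with h1 h2 h3 h3 <;> try rfl
    · have := h' β hO h1; tauto
    · have := h' β hO h1; tauto
  · simp [hO]

/-- If no wall crossed by the gallery `ω` lies in `O` up to sign, the crossing number is zero. -/
theorem crossing_wordProd_eq_zero (O : Set V) (ω : List B)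
    (h : ∀ ω₁ b ω₂, ω = ω₁ ++ b :: ω₂ → π ω₁ • Φ.root b ∉ O ∧ -(π ω₁ • Φ.root b) ∉ O) :
    Φ.crossing O (π ω) = 0 := by
  classical
  induction ω generalizing O with
  | nil => simp [crossing_one]
  | cons b ω ih =>
    rw [cs.wordProd_cons, crossing_mul, crossing_simple, ih]
    · have := h [] b ω rfl
      simp at this
      simp [this]
    · intro ω₁ c ω₂ hω
      have := h (b :: ω₁) c ω₂ (by simp [hω])
      simpa [cs.wordProd_cons, mul_smul] using this

theorem crossing_wordProd_eq_one (O : Set V) (b : B) (ω : List B) (h1 : Φ.root b ∈ O)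
    (h2 : -Φ.root b ∉ O) (h : ∀ ω₁ c ω₂, ω = ω₁ ++ c :: ω₂ →
      π (b :: ω₁) • Φ.root c ∉ O ∧ -(π (b :: ω₁) • Φ.root c) ∉ O) :
    Φ.crossing O (π (b :: ω)) = 1 := by
  classical
  rw [cs.wordProd_cons, crossing_mul, crossing_simple, crossing_wordProd_eq_zero]
  · simp [h1, h2]
  · intro ω₁ c ω₂ hω
    have := h ω₁ c ω₂ hω
    simpa [cs.wordProd_cons, mul_smul] using this

/-- The orbit of `β` under the subgroup `H`. -/
def cls (H : Subgroup W) (β : V) : Set V := {γ | ∃ m ∈ H, γ = m • β}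

theorem mem_cls_self (H : Subgroup W) (β : V) : β ∈ cls H β := ⟨1, H.one_mem, by simp⟩

theorem preimage_cls_of_mem {H : Subgroup W} {x : W} (hx : x ∈ H) (β : V) :
    {γ | x • γ ∈ cls H β} = cls H β := by
  ext γ
  constructor
  · rintro ⟨m, hm, h⟩
    exact ⟨x⁻¹ * m, H.mul_mem (H.inv_mem hx) hm, by rw [mul_smul, ← h, inv_smul_smul]⟩
  · rintro ⟨m, hm, rfl⟩
    exact ⟨x * m, H.mul_mem hx hm, (mul_smul _ _ _).symm⟩

theorem preimage_cls (H : Subgroup W) [hH : H.Normal] (w : W) (β : V) :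
    {γ | w • γ ∈ cls H β} = cls H (w⁻¹ • β) := by
  ext γ
  constructor
  · rintro ⟨m, hm, h⟩
    refine ⟨w⁻¹ * m * w, by simpa using hH.conj_mem m hm w⁻¹, ?_⟩
    simp only [mul_smul, smul_inv_smul, ← h, inv_smul_smul]
  · rintro ⟨m, hm, rfl⟩
    exact ⟨w * m * w⁻¹, hH.conj_mem m hm w, by simp only [mul_smul]⟩

theorem neg_mem_cls {H : Subgroup W} {β γ : V} : -γ ∈ cls H β ↔ γ ∈ cls H (-β) := by
  constructor
  · rintro ⟨m, hm, h⟩; exact ⟨m, hm, by rw [smul_neg, ← h, neg_neg]⟩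
  · rintro ⟨m, hm, h⟩; exact ⟨m, hm, by rw [h, smul_neg, neg_neg]⟩

theorem crossing_mul_of_mem {H : Subgroup W} {x : W} (hx : x ∈ H) (β : V) (y : W) :
    Φ.crossing (cls H β) (x * y) = Φ.crossing (cls H β) x + Φ.crossing (cls H β) y := by
  rw [crossing_mul, preimage_cls_of_mem hx]

theorem crossing_inv_of_mem {H : Subgroup W} {x : W} (hx : x ∈ H) (β : V) :
    Φ.crossing (cls H β) x⁻¹ = - Φ.crossing (cls H β) x := by
  have := crossing_mul_of_mem (Φ := Φ) hx β x⁻¹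
  rw [mul_inv_cancel, crossing_one] at this
  omega

variable (Φ) in
/-- The elements of `H` whose crossing number with each `H`-orbit of roots is even. -/
def nxt (H : Subgroup W) : Subgroup W where
  carrier := {m | m ∈ H ∧ ∀ (g : W) b, Even (Φ.crossing (cls H (g • Φ.root b)) m)}
  one_mem' := ⟨H.one_mem, fun g b => by simp [crossing_one]⟩
  mul_mem' := by
    rintro x y ⟨hx, hx'⟩ ⟨hy, hy'⟩
    refine ⟨H.mul_mem hx hy, fun g b => ?_⟩
    rw [crossing_mul_of_mem hx]
    exact (hx' g b).add (hy' g b)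
  inv_mem' := by
    rintro x ⟨hx, hx'⟩
    refine ⟨H.inv_mem hx, fun g b => ?_⟩
    rw [crossing_inv_of_mem hx]
    exact (hx' g b).neg

theorem nxt_le (H : Subgroup W) : Φ.nxt H ≤ H := fun _ h => h.1

theorem nxt_normal (H : Subgroup W) [hH : H.Normal] : (Φ.nxt H).Normal := by
  refine ⟨fun m hm w => ⟨hH.conj_mem m hm.1 w, fun g b => ?_⟩⟩
  have h1 : Φ.crossing (cls H (g • Φ.root b)) w +
      Φ.crossing (cls H (w⁻¹ • g • Φ.root b)) w⁻¹ = 0 := by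
    rw [← preimage_cls, ← crossing_mul, mul_inv_cancel, crossing_one]
  rw [mul_assoc, crossing_mul, preimage_cls, crossing_mul_of_mem hm.1, add_left_comm, h1, add_zero,
    ← mul_smul]
  exact hm.2 _ _

/-- The crossing number with an `H`-orbit, as a homomorphism on `H`. -/
noncomputable def crossingHom (Φ : RootData cs V) (H : Subgroup W) (β : V) :
    H →* Multiplicative ℤ where
  toFun m := Multiplicative.ofAdd (Φ.crossing (cls H β) m)
  map_one' := by simp [crossing_one]
  map_mul' x y := by
    rw [Subgroup.coe_mul, crossing_mul_of_mem x.2, ofAdd_add]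

theorem cls_eq_of_mem {H : Subgroup W} {β γ : V} (h : γ ∈ cls H β) : cls H γ = cls H β := by
  obtain ⟨m, hm, rfl⟩ := h
  ext δ
  constructor
  · rintro ⟨k, hk, rfl⟩; exact ⟨k * m, H.mul_mem hk hm, (mul_smul _ _ _).symm⟩
  · rintro ⟨k, hk, rfl⟩
    exact ⟨k * m⁻¹, H.mul_mem hk (H.inv_mem hm), by rw [mul_smul, inv_smul_smul]⟩

theorem nxt_finiteIndex [Finite B] (H : Subgroup W) [hH : H.Normal] [H.FiniteIndex] :
    (Φ.nxt H).FiniteIndex := by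
  let f : H →* ((W ⧸ H) × B → Multiplicative (ZMod 2)) :=
    MonoidHom.pi fun p => (AddMonoidHom.toMultiplicative (Int.castAddHom (ZMod 2))).comp
      (crossingHom Φ H (p.1.out • Φ.root p.2))
  have : Finite (Multiplicative (ZMod 2)) := inferInstanceAs (Finite (ZMod 2))
  have h1 : f.ker.FiniteIndex := Subgroup.finiteIndex_ker f
  have h2 : (f.ker.map H.subtype).FiniteIndex := by
    constructor
    rw [Subgroup.index_map_subtype]
    exact mul_ne_zero h1.index_ne_zero Subgroup.FiniteIndex.index_ne_zero
  refine Subgroup.finiteIndex_of_le (H := f.ker.map H.subtype) ?_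
  rintro _ ⟨m, hm, rfl⟩
  refine ⟨m.2, fun g b => ?_⟩
  have h3 := congrFun (MonoidHom.mem_ker.1 hm) (QuotientGroup.mk g, b)
  have h4 : ((Φ.crossing (cls H ((QuotientGroup.mk g : W ⧸ H).out • Φ.root b)) m : ℤ) : ZMod 2)
      = 0 := h3
  obtain ⟨h, hh⟩ := QuotientGroup.mk_out_eq_mul H g
  have h5 : (g * (h : W)) • Φ.root b ∈ cls H (g • Φ.root b) :=
    ⟨g * h * g⁻¹, hH.conj_mem _ h.2 _, by simp [mul_smul]⟩
  rw [hh, cls_eq_of_mem h5] at h4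
  exact (ZMod.intCast_eq_zero_iff_even).1 h4

theorem ratDer_subset_nxt (H : Subgroup W) {x : W} {k : ℤ} (hx : x ∈ H) (hk : k ≠ 0)
    (h : x ^ k ∈ ⁅H, H⁆) : x ∈ Φ.nxt H := by
  refine ⟨hx, fun g b => ?_⟩
  have h1 : ⁅H, H⁆ ≤ (crossingHom Φ H (g • Φ.root b)).ker.map H.subtype := by
    rw [Subgroup.commutator_le]
    intro a ha c hc
    refine ⟨⟨a, ha⟩ * ⟨c, hc⟩ * ⟨a, ha⟩⁻¹ * ⟨c, hc⟩⁻¹, MonoidHom.mem_ker.2 ?_, rfl⟩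
    rw [map_mul, map_mul, map_mul, map_inv, map_inv, mul_right_comm _ _ (_⁻¹), mul_inv_cancel_right,
      mul_inv_cancel]
  obtain ⟨y, hy, hyx⟩ := h1 h
  have h2 : y = ⟨x, hx⟩ ^ k := Subtype.ext (by simpa using hyx)
  have h3 : k • Φ.crossing (cls H (g • Φ.root b)) x = 0 := by
    have := MonoidHom.mem_ker.1 hy
    rw [h2, map_zpow] at this
    exact this
  have h4 : Φ.crossing (cls H (g • Φ.root b)) x = 0 := by simpa [hk] using h3
  simp [h4]

theorem reflection_mul_mem {H : Subgroup W} [hH : H.Normal] {g v : W} {b c : B}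
    (h : g • Φ.root b ∈ cls H (v • Φ.root c) ∨ -(g • Φ.root b) ∈ cls H (v • Φ.root c)) :
    (g * σ b * g⁻¹) * (v * σ c * v⁻¹) ∈ H := by
  obtain ⟨m, hm, h⟩ : ∃ m ∈ H, g * σ b * g⁻¹ = (m * v) * σ c * (m * v)⁻¹ := by
    obtain ⟨m, hm, h⟩ | ⟨m, hm, h⟩ := h
    · exact ⟨m, hm, Φ.reflection_eq _ _ _ _ (by rw [h, mul_smul])⟩
    · exact ⟨m, hm, reflection_eq_of_neg (Φ := Φ) (by rw [mul_smul, ← h, neg_neg])⟩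
  rw [h]
  have h2 := hH.conj_mem _ (H.inv_mem hm) (v * σ c * v⁻¹)
  have h3 := H.mul_mem hm h2
  convert h3 using 1
  simp [mul_assoc]

theorem reflection_mul_simple_mem {H : Subgroup W} [hH : H.Normal] {g : W} {b c : B}
    (h : g • Φ.root b ∈ cls H (Φ.root c) ∨ -(g • Φ.root b) ∈ cls H (Φ.root c)) :
    (g * σ b * g⁻¹) * σ c ∈ H := by
  rw [← one_smul W (Φ.root c)] at h
  simpa using reflection_mul_mem h

theorem odd_crossing_reflection {H : Subgroup W} [H.Normal] {g : W} {b : B}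
    (hneg : ∀ n ∈ H, n • Φ.root b ≠ -Φ.root b) :
    Odd (Φ.crossing (cls H (g • Φ.root b)) (g * σ b * g⁻¹)) := by
  classical
  have h1 : Φ.root b ∈ cls H (Φ.root b) := mem_cls_self _ _
  have h2 : -Φ.root b ∉ cls H (Φ.root b) := fun ⟨m, hm, h⟩ => hneg m hm h.symm
  have h3 : Φ.crossing (cls H (g • Φ.root b)) g + Φ.crossing (cls H (Φ.root b)) g⁻¹ = 0 := by
    have : Φ.root b = g⁻¹ • g • Φ.root b := by simp
    conv_lhs => rw [this]
    rw [smul_inv_smul, ← preimage_cls, ← crossing_mul, mul_inv_cancel, crossing_one]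
  have h4 : {γ | σ b • γ ∈ cls H (Φ.root b)} = {γ | -γ ∈ cls H (Φ.root b)} := by
    rw [preimage_cls, CoxeterSystem.inv_simple, Φ.simple_smul_root]
    ext γ
    exact neg_mem_cls.symm
  rw [mul_assoc, crossing_mul, preimage_cls, inv_smul_smul, crossing_mul, crossing_simple, h4,
    crossing_neg]
  simp only [h1, h2, if_true, if_false]
  exact ⟨Φ.crossing (cls H (g • Φ.root b)) g, by omega⟩

theorem mem_cls_of_reflection_mul_mem_nxt {H : Subgroup W} [H.Normal] {g : W} {b c : B}
    (hneg : ∀ n ∈ H, n • Φ.root b ≠ -Φ.root b) (h : (g * σ b * g⁻¹) * σ c ∈ Φ.nxt H) :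
    Φ.root c ∈ cls H (g • Φ.root b) ∨ -Φ.root c ∈ cls H (g • Φ.root b) := by
  classical
  by_contra! h'
  have h1 := odd_crossing_reflection (Φ := Φ) (g := g) hneg
  have h2 := h.2 g b
  have h3 : (g * σ b * g⁻¹)⁻¹ • g • Φ.root b = -(g • Φ.root b) := by
    simp [mul_smul, Φ.simple_smul_root]
  have h4 : Φ.root c ∉ cls H (-(g • Φ.root b)) := fun h => h'.2 (neg_mem_cls.2 h)
  have h5 : -Φ.root c ∉ cls H (-(g • Φ.root b)) := fun h =>
    h'.1 (by simpa using neg_mem_cls.2 h)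
  rw [crossing_mul, preimage_cls, h3, crossing_simple] at h2
  simp only [h4, h5, if_false, sub_zero, add_zero] at h2
  exact (Int.not_even_iff_odd.2 h1) h2

/-- The alternating word of length `k` starting with `x`. -/
def altWord (x y : B) : ℕ → List B
  | 0 => []
  | k + 1 => x :: altWord y x k
termination_by k => k

theorem length_altWord (x y : B) (k : ℕ) : (altWord x y k).length = k := by
  induction k generalizing x y with
  | zero => simp [altWord]
  | succ k ih => simp [altWord, ih]

theorem dropLast_altWord (x y : B) (k : ℕ) : (altWord x y (k + 1)).dropLast = altWord x y k := by
  induction k generalizing x y with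
  | zero => simp [altWord]
  | succ k ih =>
    rw [altWord, List.dropLast_cons_of_ne_nil (by simp [altWord]), ih, altWord]

theorem swap_pow (x y : B) (k : ℕ) : σ x * (σ y * σ x) ^ k * σ y = (σ x * σ y) ^ (k + 1) := by
  induction k with
  | zero => simp
  | succ k ih =>
    rw [pow_succ' _ (k + 1), ← ih, pow_succ']
    simp only [mul_assoc]

theorem wordProd_altWord_mul_inv (x y : B) (k : ℕ) :
    π (altWord x y k) * (π (altWord y x k))⁻¹ = (σ x * σ y) ^ k := by
  induction k generalizing x y with
  | zero => simp [altWord]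
  | succ k ih =>
    rw [← swap_pow, ← ih y x]
    simp [altWord, cs.wordProd_cons, mul_assoc]

theorem altWord_reflection (x y : B) (k : ℕ) : ∃ z, (z = x ∨ z = y) ∧
    π (altWord x y k) * σ z * (π (altWord x y k))⁻¹ = (σ x * σ y) ^ k * σ x := by
  induction k generalizing x y with
  | zero => exact ⟨x, by simp [altWord]⟩
  | succ k ih =>
    obtain ⟨z, hz, h⟩ := ih y x
    refine ⟨z, hz.symm, ?_⟩
    have : σ x * ((σ y * σ x) ^ k * σ y) * σ x = (σ x * σ y) ^ (k + 1) * σ x := by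
      rw [← mul_assoc, swap_pow]
    rw [← this, ← h]
    simp [altWord, cs.wordProd_cons, mul_assoc]

theorem altWord_eq_append {x y c : B} {k : ℕ} {ω₁ ω₂ : List B}
    (h : altWord x y k = ω₁ ++ c :: ω₂) : ω₁.length < k ∧
    π ω₁ * σ c * (π ω₁)⁻¹ = (σ x * σ y) ^ ω₁.length * σ x := by
  induction k generalizing x y ω₁ with
  | zero => simp [altWord] at h
  | succ k ih =>
    cases ω₁ with
    | nil =>
      simp only [altWord, List.nil_append, List.cons.injEq] at h
      simp [h.1]
    | cons d ω₁ =>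
      simp only [altWord, List.cons_append, List.cons.injEq] at h
      obtain ⟨rfl, h⟩ := h
      obtain ⟨h1, h2⟩ := ih h
      refine ⟨by simpa using h1, ?_⟩
      rw [List.length_cons, ← swap_pow, mul_assoc (σ x), ← h2]
      simp [cs.wordProd_cons, mul_assoc]

/-- Two words of length `q` with distinct products in the same coset of `H`. -/
structure IsBadPair (cs : CoxeterSystem M W) (H : Subgroup W) (q : ℕ) (a b : List B) : Prop where
  length_left : a.length = q
  length_right : b.length = q
  ne : cs.wordProd a ≠ cs.wordProd b
  mem : (cs.wordProd a)⁻¹ * cs.wordProd b ∈ H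

theorem IsBadPair.symm {H : Subgroup W} {q : ℕ} {a b : List B} (h : IsBadPair cs H q a b) :
    IsBadPair cs H q b a :=
  ⟨h.length_right, h.length_left, h.ne.symm, by simpa using H.inv_mem h.mem⟩

section BadPair

variable {H : Subgroup W} [hH : H.Normal] {q : ℕ} {a b' : List B} {u : B}

theorem IsBadPair.crossing_right (h : IsBadPair cs H q a (u :: b'))
    (hneg : ∀ n ∈ H, ∀ b, n • Φ.root b ≠ -Φ.root b)
    (hsmall : ∀ ω : List B, ω.length < 2 * q → π ω ∈ H → π ω = 1) :
    Φ.crossing (cls H (Φ.root u)) (π (u :: b')) = 1 := by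
  apply crossing_wordProd_eq_one _ _ _ (mem_cls_self _ _)
  · rintro ⟨m, hm, hm'⟩
    exact hneg m hm u hm'.symm
  rintro ω₁ x ω₂ rfl
  rw [← not_or]
  intro h'
  have hq := h.length_right
  have hq' := h.length_left
  simp at hq
  have h1 := reflection_mul_simple_mem h'
  have h2 := hH.conj_mem _ h1 (σ u)
  have h3 : π (ω₁ ++ x :: ω₁.reverse ++ [u]) = 1 := by
    apply hsmall
    · simp; omega
    · convert h2 using 1
      simp [cs.wordProd_append, cs.wordProd_cons, mul_assoc]
  have h4 : π (u :: (ω₁ ++ x :: ω₂)) = π (ω₁ ++ ω₂) := by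
    have : σ u = π ω₁ * σ x * (π ω₁)⁻¹ := by
      simp only [cs.wordProd_append, cs.wordProd_cons, cs.wordProd_reverse, cs.wordProd_nil,
        mul_one] at h3
      rw [mul_eq_one_iff_eq_inv] at h3
      rw [mul_assoc, h3, cs.inv_simple]
    rw [cs.wordProd_cons, this]
    simp [cs.wordProd_append, cs.wordProd_cons, mul_assoc]
  have h5 := h.mem
  rw [h4] at h5
  have h6 : π (a.reverse ++ (ω₁ ++ ω₂)) = 1 := by
    apply hsmall
    · simp; omega
    · rwa [cs.wordProd_append, cs.wordProd_reverse]
  apply h.ne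
  rw [h4]
  rwa [cs.wordProd_append, cs.wordProd_reverse, inv_mul_eq_one] at h6

theorem IsBadPair.wordProd_right (h : IsBadPair cs H q a (u :: b'))
    (hneg : ∀ n ∈ H, ∀ b, n • Φ.root b ≠ -Φ.root b)
    (hsmall : ∀ ω : List B, ω.length < 2 * q → π ω ∈ H → π ω = 1)
    (heq : ∀ ω : List B, ω.length = 2 * q → π ω ∈ H → π ω ∈ Φ.nxt H) :
    π (u :: b') = π (u :: a.dropLast) := by
  have hq := h.length_right
  have hq' := h.length_left
  simp at hq
  have h1 := h.crossing_right hneg hsmall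
  have h2 : (π (u :: b'))⁻¹ * π a ∈ Φ.nxt H := by
    have := heq ((u :: b').reverse ++ a) (by simp; omega)
    rw [cs.wordProd_append, cs.wordProd_reverse] at this
    exact this h.symm.mem
  have h3 : Φ.crossing (cls H (Φ.root u)) (π a) ≠ 0 := by
    intro h0
    have : π a = π (u :: b') * ((π (u :: b'))⁻¹ * π a) := by simp
    rw [this, crossing_mul, h1, preimage_cls] at h0
    have := h2.2 (π (u :: b'))⁻¹ u
    rw [Int.even_iff] at this
    omega
  obtain ⟨ω₁, x, ω₂, rfl, h4⟩ : ∃ ω₁ x ω₂, a = ω₁ ++ x :: ω₂ ∧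
      (π ω₁ • Φ.root x ∈ cls H (Φ.root u) ∨ -(π ω₁ • Φ.root x) ∈ cls H (Φ.root u)) := by
    by_contra! h'
    exact h3 (crossing_wordProd_eq_zero _ _ h')
  have h5 := reflection_mul_simple_mem h4
  have h6 := hH.conj_mem _ h5 (π b')⁻¹
  have h7 : π (b'.reverse ++ (ω₁ ++ ω₂)) ∈ H := by
    convert H.mul_mem h6 h.symm.mem using 1
    simp [cs.wordProd_append, cs.wordProd_cons, cs.wordProd_reverse, mul_assoc]
  have h8 := hsmall _ (by simp at hq' ⊢; omega) h7
  rw [cs.wordProd_append, cs.wordProd_reverse, inv_mul_eq_one] at h8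
  rw [cs.wordProd_cons, h8, cs.wordProd_cons]
  rcases List.eq_nil_or_concat ω₂ with rfl | ⟨ω₂', z, rfl⟩
  · simp
  · exfalso
    have h9 := hH.conj_mem _ h.symm.mem (σ z)
    have h10 : π ((u :: ω₁ ++ ω₂').reverse ++ (ω₁ ++ x :: ω₂')) = 1 := by
      apply hsmall
      · simp at hq' ⊢; omega
      · convert h9 using 1
        rw [cs.wordProd_cons, h8]
        simp [cs.wordProd_append, cs.wordProd_cons, cs.wordProd_reverse, mul_assoc,
          List.concat_eq_append]
    rw [cs.wordProd_append, cs.wordProd_reverse, inv_mul_eq_one] at h10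
    apply h.ne
    rw [cs.wordProd_cons, h8]
    have := congrArg (· * σ z) h10.symm
    simpa [cs.wordProd_append, cs.wordProd_cons, mul_assoc, List.concat_eq_append] using this

end BadPair

theorem IsBadPair.exists_altWord {H : Subgroup W} [hH : H.Normal] {q k : ℕ} {x y : B}
    {p r : List B} (h : IsBadPair cs H q (altWord x y (k + 1) ++ p) (y :: r))
    (hneg : ∀ n ∈ H, ∀ b, n • Φ.root b ≠ -Φ.root b)
    (hsmall : ∀ ω : List B, ω.length < 2 * q → π ω ∈ H → π ω = 1)
    (heq : ∀ ω : List B, ω.length = 2 * q → π ω ∈ H → π ω ∈ Φ.nxt H) :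
    ∃ x y, IsBadPair cs H q (altWord x y q) (altWord y x q) := by
  induction hp : p.length generalizing x y k p r with
  | zero =>
    obtain rfl : p = [] := List.length_eq_zero_iff.1 hp
    rw [List.append_nil] at h
    have hq : k + 1 = q := by simpa [length_altWord] using h.length_left
    have h1 := h.wordProd_right hneg hsmall heq
    rw [dropLast_altWord] at h1
    subst hq
    refine ⟨x, y, length_altWord _ _ _, length_altWord _ _ _, ?_, ?_⟩
    · rw [altWord.eq_2 y, ← h1]; exact h.ne
    · rw [altWord.eq_2 y, ← h1]; exact h.mem
  | succ n ih =>
    have hp' : p ≠ [] := by rintro rfl; simp at hp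
    have h1 := h.wordProd_right hneg hsmall heq
    have h2 : IsBadPair cs H q (altWord y x (k + 2) ++ p.dropLast)
        (x :: (altWord y x k ++ p)) := by
      have h3 : altWord y x (k + 2) ++ p.dropLast =
          y :: (altWord x y (k + 1) ++ p).dropLast := by
        rw [altWord, List.cons_append, List.dropLast_append_of_ne_nil hp']
      have h4 : x :: (altWord y x k ++ p) = altWord x y (k + 1) ++ p := by
        rw [altWord, List.cons_append]
      rw [h3, h4]
      refine ⟨?_, h.length_left, ?_, ?_⟩
      · have := h.length_left
        simp at this ⊢
        omega
      · rw [← h1]; exact h.ne.symm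
      · rw [← h1]; exact h.symm.mem
    exact ih h2 (by simp [hp])

variable (Φ) in
/-- All four sign patterns of the pair `(β, γ)` occur in its orbit. -/
def Cross (β γ : V) : Prop :=
  (∃ g : W, Φ.pos (g • β) ∧ Φ.pos (g • γ)) ∧ (∃ g : W, Φ.pos (g • β) ∧ Φ.pos (-(g • γ))) ∧
  (∃ g : W, Φ.pos (-(g • β)) ∧ Φ.pos (g • γ)) ∧ (∃ g : W, Φ.pos (-(g • β)) ∧ Φ.pos (-(g • γ)))

theorem cross_of_signs {y z : B} {w : W} {γ : V} (hδr' : Φ.IsRoot γ)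
    (hwy : w • Φ.root y = Φ.root z ∨ w • Φ.root y = -Φ.root z)
    (hδy : γ ≠ Φ.root y ∧ γ ≠ -Φ.root y) (hδz : w • γ ≠ Φ.root z ∧ w • γ ≠ -Φ.root z)
    (hsign : Φ.pos (w • γ) ↔ ¬ Φ.pos γ) : Φ.Cross (Φ.root y) γ := by
  have hδr := isRoot_smul hδr' w
  have hy := Φ.pos_root y
  have hz' := Φ.pos_root z
  have s1 := hδr'.pos_simple_smul_iff hδy.1 hδy.2
  have s2 := hδr.pos_simple_smul_iff hδz.1 hδz.2
  have t1 := hδr.not_pos_iff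
  have t2 := hδr'.not_pos_iff
  have t3 := (isRoot_smul hδr (σ z)).not_pos_iff
  have t4 := (isRoot_smul hδr' (σ y)).not_pos_iff
  have u1 : (σ y) • Φ.root y = -Φ.root y := Φ.simple_smul_root y
  have u2 : (σ z) • Φ.root z = -Φ.root z := Φ.simple_smul_root z
  by_cases hp : Φ.pos γ
  · have hp2 : ¬ Φ.pos (w • γ) := fun h => hsign.1 h hp
    have a1 : ∃ g : W, Φ.pos (g • Φ.root y) ∧ Φ.pos (g • γ) := ⟨1, by simpa using ⟨hy, hp⟩⟩
    have a2 : ∃ g : W, Φ.pos (-(g • Φ.root y)) ∧ Φ.pos (g • γ) :=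
      ⟨σ y, by rw [u1, neg_neg]; exact ⟨hy, s1.2 hp⟩⟩
    rcases hwy with h | h
    · refine ⟨a1, ⟨w, ?_⟩, a2, ⟨σ z * w, ?_⟩⟩
      · rw [h]; exact ⟨hz', t1.1 hp2⟩
      · rw [mul_smul, mul_smul, h, u2, neg_neg]; exact ⟨hz', t3.1 (s2.not.2 hp2)⟩
    · refine ⟨a1, ⟨σ z * w, ?_⟩, a2, ⟨w, ?_⟩⟩
      · rw [mul_smul, mul_smul, h, smul_neg, u2, neg_neg]
        exact ⟨hz', t3.1 (s2.not.2 hp2)⟩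
      · rw [h, neg_neg]; exact ⟨hz', t1.1 hp2⟩
  · have hp2 : Φ.pos (w • γ) := hsign.2 hp
    have a1 : ∃ g : W, Φ.pos (g • Φ.root y) ∧ Φ.pos (-(g • γ)) :=
      ⟨1, by simpa using ⟨hy, t2.1 hp⟩⟩
    have a2 : ∃ g : W, Φ.pos (-(g • Φ.root y)) ∧ Φ.pos (-(g • γ)) :=
      ⟨σ y, by rw [u1, neg_neg]; exact ⟨hy, t4.1 (s1.not.2 hp)⟩⟩
    rcases hwy with h | h
    · refine ⟨⟨w, ?_⟩, a1, ⟨σ z * w, ?_⟩, a2⟩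
      · rw [h]; exact ⟨hz', hp2⟩
      · rw [mul_smul, mul_smul, h, u2, neg_neg]; exact ⟨hz', s2.2 hp2⟩
    · refine ⟨⟨σ z * w, ?_⟩, a1, ⟨w, ?_⟩, a2⟩
      · rw [mul_smul, mul_smul, h, smul_neg, u2, neg_neg]
        exact ⟨hz', s2.2 hp2⟩
      · rw [h, neg_neg]; exact ⟨hz', hp2⟩

theorem pow_mem_of_pow_mem_nxt {H : Subgroup W} [hH : H.Normal] {x y : B} {r : ℕ}
    (hneg : ∀ n ∈ H, ∀ b, n • Φ.root b ≠ -Φ.root b)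
    (hcross : ∀ n ∈ H, ¬ Φ.Cross (Φ.root y) (n • Φ.root x))
    (hr : 2 ≤ r) (h : (σ x * σ y) ^ r ∈ Φ.nxt (Φ.nxt H)) :
    ∃ j, 1 ≤ j ∧ j < r ∧ (σ x * σ y) ^ j ∈ H := by
  classical
  by_contra! hj
  have := nxt_normal (Φ := Φ) H
  obtain ⟨k, rfl⟩ : ∃ k, r = k + 2 := ⟨r - 2, by omega⟩
  obtain ⟨z, -, hz⟩ := altWord_reflection (cs := cs) x y (k + 1)
  set v := π (altWord x y (k + 1)) with hv
  have hrefl : v * σ z * v⁻¹ * σ y = (σ x * σ y) ^ (k + 2) := by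
    rw [hz, mul_assoc, ← pow_succ]
  have hpow : ∀ j, (σ x * σ y) ^ j * σ x * σ x = (σ x * σ y) ^ j := by simp [mul_assoc]
  rw [← hrefl] at h
  obtain ⟨n, hn, hny⟩ : ∃ n ∈ Φ.nxt H,
      Φ.root y = n • v • Φ.root z ∨ Φ.root y = -(n • v • Φ.root z) := by
    rcases mem_cls_of_reflection_mul_mem_nxt (fun n hn => hneg n (nxt_le H hn) z) h with
      ⟨n, hn, h'⟩ | ⟨n, hn, h'⟩
    · exact ⟨n, hn, .inl h'⟩
    · exact ⟨n, hn, .inr (by rw [← h', neg_neg])⟩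
  set w := v⁻¹ * n⁻¹ with hw
  have hwy : w • Φ.root y = Φ.root z ∨ w • Φ.root y = -Φ.root z := by
    rcases hny with h | h <;> rw [h] <;> simp [hw, mul_smul]
  have heven : Even (Φ.crossing (cls H (Φ.root x)) n⁻¹) := by
    simpa using ((Φ.nxt H).inv_mem hn).2 1 x
  have hv1 : Φ.crossing (cls H (Φ.root x)) v = 1 := by
    rw [hv, altWord]
    apply crossing_wordProd_eq_one _ _ _ (mem_cls_self _ _)
    · rintro ⟨m, hm, hm'⟩
      exact hneg m hm x hm'.symm
    rintro ω₁ c ω₂ hω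
    rw [← not_or]
    intro h'
    have h1 : altWord x y (k + 1) = (x :: ω₁) ++ c :: ω₂ := by simp [altWord, hω]
    obtain ⟨h2, h3⟩ := altWord_eq_append (cs := cs) h1
    have h4 := reflection_mul_simple_mem h'
    rw [h3, hpow] at h4
    exact hj _ (by simp) (by omega) h4
  have hodd : Φ.crossing {δ | v • δ ∈ cls H (Φ.root x)} w ≠ 0 := by
    intro h0
    have : n⁻¹ = v * w := by simp [hw]
    rw [this, crossing_mul, hv1, h0] at heven
    simp at heven
  obtain ⟨δ, ⟨m, hm, hδ⟩, hδr, hsign⟩ := exists_of_crossing_ne_zero hodd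
  have hδz : δ ≠ Φ.root z ∧ δ ≠ -Φ.root z := by
    rw [← not_or]
    intro h'
    have h1 : v • Φ.root z ∈ cls H (Φ.root x) ∨ -(v • Φ.root z) ∈ cls H (Φ.root x) := by
      rcases h' with rfl | rfl
      · exact .inl ⟨m, hm, hδ⟩
      · exact .inr ⟨m, hm, by rw [← hδ, smul_neg]⟩
    have h2 := reflection_mul_simple_mem h1
    rw [hz, hpow] at h2
    exact hj _ (by omega) (by omega) h2
  have hw' : w⁻¹ • δ = (n * m) • Φ.root x := by
    rw [mul_smul, ← hδ]; simp [hw, mul_smul]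
  have hδy : w⁻¹ • δ ≠ Φ.root y ∧ w⁻¹ • δ ≠ -Φ.root y := by
    rw [Ne, Ne, inv_smul_eq_iff, inv_smul_eq_iff, smul_neg]
    rcases hwy with h | h <;> rw [h]
    · exact hδz
    · rw [neg_neg]; exact hδz.symm
  apply hcross (n * m) (H.mul_mem (nxt_le H hn) hm)
  rw [← hw']
  refine cross_of_signs (w := w) (isRoot_smul hδr w⁻¹) hwy hδy ?_ ?_ <;> rw [smul_inv_smul]
  · exact hδz
  · exact hsign

variable (Φ) in
/-- The conditions on a normal subgroup guaranteeing that iterating `nxt` exhausts it. -/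
structure IsGood (N : Subgroup W) : Prop where
  neg : ∀ n ∈ N, ∀ b, n • Φ.root b ≠ -Φ.root b
  parity : N ≤ cs.lengthParity.ker
  cross : ∀ b c, M b c = 0 → ∀ n ∈ N, ¬ Φ.Cross (Φ.root b) (n • Φ.root c)
  mul_notMem : ∀ b c, M b c = 0 → σ b * σ c ∉ N
  pow_eq_one : ∀ b c, M b c ≠ 0 → ∀ k, (σ b * σ c) ^ k ∈ N → (σ b * σ c) ^ k = 1

theorem even_length_of_mem {N : Subgroup W} (hN : N ≤ cs.lengthParity.ker) {ω : List B}
    (h : π ω ∈ N) : Even ω.length := by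
  have h1 : ∀ ω : List B, cs.lengthParity (π ω) = Multiplicative.ofAdd (ω.length : ZMod 2) := by
    intro ω
    induction ω with
    | nil => simp
    | cons b ω ih =>
      rw [cs.wordProd_cons, map_mul, ih, cs.lengthParity_simple, ← ofAdd_add]
      simp [add_comm]
  have h2 := MonoidHom.mem_ker.1 (hN h)
  rw [h1] at h2
  exact (ZMod.natCast_eq_zero_iff_even).1 h2

theorem IsGood.eq_one {N H : Subgroup W} [hH : H.Normal] (hN : Φ.IsGood N) (hHN : H ≤ N) {L : ℕ}
    (hL : ∀ ω : List B, ω.length ≤ L → π ω ∈ H → π ω ∈ Φ.nxt (Φ.nxt H)) (ω : List B)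
    (hω : ω.length ≤ L) (hωH : π ω ∈ H) : π ω = 1 := by
  classical
  have hneg : ∀ n ∈ H, ∀ b, n • Φ.root b ≠ -Φ.root b := fun n hn => hN.neg n (hHN hn)
  induction hl : ω.length using Nat.strong_induction_on generalizing ω with
  | _ l ih =>
  obtain ⟨q, hq⟩ := even_length_of_mem (hHN.trans hN.parity) hωH
  by_contra hne
  have hsmall : ∀ ω : List B, ω.length < 2 * q → π ω ∈ H → π ω = 1 := fun ω' h1 h2 =>
    ih _ (by omega) ω' (by omega) h2 rfl
  have heq : ∀ ω : List B, ω.length = 2 * q → π ω ∈ H → π ω ∈ Φ.nxt H := fun ω' h1 h2 =>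
    nxt_le _ (hL ω' (by omega) h2)
  have hq0 : q ≠ 0 := by
    rintro rfl
    obtain rfl : ω = [] := List.length_eq_zero_iff.1 (by omega)
    simp at hne
  have hsplit : π ω = π (ω.take q) * π (ω.drop q) := by
    rw [← cs.wordProd_append, List.take_append_drop]
  obtain ⟨a, ha⟩ : ∃ a, a = (ω.take q).reverse := ⟨_, rfl⟩
  obtain ⟨b, hb⟩ : ∃ b, b = ω.drop q := ⟨_, rfl⟩
  have hbad : IsBadPair cs H q a b := by
    have h1 : π ω = (π a)⁻¹ * π b := by rw [hsplit, ha, cs.wordProd_reverse, inv_inv, hb]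
    refine ⟨by simp [ha]; omega, by simp [hb]; omega, ?_, h1 ▸ hωH⟩
    intro h
    apply hne
    rw [h1, h, inv_mul_cancel]
  obtain ⟨x, y, hxy⟩ : ∃ x y, IsBadPair cs H q (altWord x y q) (altWord y x q) := by
    have hla := hbad.length_left
    have hlb := hbad.length_right
    cases a with
    | nil => simp at hla; omega
    | cons x p =>
      cases b with
      | nil => simp at hlb; omega
      | cons y r =>
        exact IsBadPair.exists_altWord (k := 0) (x := x) (p := p) (y := y) (r := r)
          (by simpa [altWord] using hbad) hneg hsmall heq
  have hG : (σ x * σ y) ^ q ∈ H := by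
    rw [← wordProd_altWord_mul_inv]
    simpa [mul_assoc] using hH.conj_mem _ hxy.symm.mem (π (altWord y x q))
  have hG1 : (σ x * σ y) ^ q ≠ 1 := by
    rw [← wordProd_altWord_mul_inv, Ne, mul_inv_eq_one]
    exact hxy.ne
  by_cases hM : M x y = 0
  · have hex : ∃ r, 1 ≤ r ∧ (σ x * σ y) ^ r ∈ H := ⟨q, by omega, hG⟩
    obtain ⟨h1, h2⟩ := Nat.find_spec hex
    have h3 : Nat.find hex ≤ q := Nat.find_min' hex ⟨by omega, hG⟩
    have h4 : ∀ j, 1 ≤ j → j < Nat.find hex → (σ x * σ y) ^ j ∉ H := fun j hj hj' h =>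
      Nat.find_min hex hj' ⟨hj, h⟩
    obtain ⟨j, hj1, hj2, hj3⟩ := pow_mem_of_pow_mem_nxt (r := Nat.find hex) (x := x) (y := y) hneg
      (fun n hn => hN.cross y x (by rw [M.symmetric]; exact hM) n (hHN hn)) (by
        by_contra h5
        have h6 : Nat.find hex = 1 := by omega
        rw [h6, pow_one] at h2
        exact hN.mul_notMem x y hM (hHN h2)) (by
        have h5 : (σ x * σ y) ^ Nat.find hex = π (altWord x y (Nat.find hex) ++
          (altWord y x (Nat.find hex)).reverse) := by
          rw [cs.wordProd_append, cs.wordProd_reverse, wordProd_altWord_mul_inv]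
        rw [h5]
        apply hL
        · simp [length_altWord]; omega
        · rw [← h5]; exact h2)
    exact h4 j hj1 hj2 hj3
  · exact hG1 (hN.pow_eq_one x y hM q (hHN hG))

/-- The iterates of `nxt`. -/
def iterNxt (Φ : RootData cs V) (N : Subgroup W) (i : ℕ) : Subgroup W := Φ.nxt^[i] N

theorem iterNxt_succ (N : Subgroup W) (i : ℕ) :
    Φ.iterNxt N (i + 1) = Φ.nxt (Φ.iterNxt N i) := Function.iterate_succ_apply' _ _ _

theorem iterNxt_antitone (N : Subgroup W) : Antitone (Φ.iterNxt N) :=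
  antitone_nat_of_succ_le fun i => by rw [iterNxt_succ]; exact nxt_le _

theorem iterNxt_normal (N : Subgroup W) [hN : N.Normal] (i : ℕ) : (Φ.iterNxt N i).Normal := by
  induction i with
  | zero => exact hN
  | succ i ih => rw [iterNxt_succ]; exact nxt_normal _

theorem iterNxt_finiteIndex [Finite B] (N : Subgroup W) [hN : N.Normal] [hN' : N.FiniteIndex]
    (i : ℕ) : (Φ.iterNxt N i).FiniteIndex := by
  induction i with
  | zero => exact hN'
  | succ i ih =>
    have := iterNxt_normal (Φ := Φ) N i
    rw [iterNxt_succ]; exact nxt_finiteIndex _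

theorem IsGood.eq_one_of_forall_mem [Finite B] {N : Subgroup W} [N.Normal] (hN : Φ.IsGood N)
    {w : W} (hw : ∀ i, w ∈ Φ.iterNxt N i) : w = 1 := by
  obtain ⟨ω, rfl⟩ := cs.wordProd_surjective w
  have hfin : {ω' : List B | ω'.length ≤ ω.length}.Finite := List.finite_length_le B ω.length
  have h1 : ∀ ω' : List B, ∃ i, π ω' ∈ Φ.iterNxt N i → ∀ j, π ω' ∈ Φ.iterNxt N j := by
    intro ω'
    by_cases h : ∀ j, π ω' ∈ Φ.iterNxt N j
    · exact ⟨0, fun _ => h⟩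
    · push Not at h
      obtain ⟨i, hi⟩ := h
      exact ⟨i, fun h => absurd h hi⟩
  choose f hf using h1
  obtain ⟨i, hi⟩ := (hfin.image f).bddAbove
  have := iterNxt_normal (Φ := Φ) N i
  refine hN.eq_one (H := Φ.iterNxt N i) (iterNxt_antitone N (Nat.zero_le i)) (L := ω.length)
    (fun ω' h1 h2 => ?_) ω le_rfl (hw i)
  rw [← iterNxt_succ, ← iterNxt_succ]
  exact hf ω' (iterNxt_antitone N (hi ⟨ω', h1, rfl⟩) h2) _

theorem IsGood.isRFRS [Finite B] {N : Subgroup W} [N.Normal] [N.FiniteIndex]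
    (hN : Φ.IsGood N) : IsRFRS N := by
  have hle : ∀ i, Φ.iterNxt N i ≤ N := fun i => iterNxt_antitone N (Nat.zero_le i)
  refine ⟨fun i => (Φ.iterNxt N i).subgroupOf N, ?_, fun i => ?_, fun i => ?_, fun i => ?_, ?_,
    fun i => ?_⟩
  · exact Subgroup.subgroupOf_self N
  · have := iterNxt_normal (Φ := Φ) N i
    infer_instance
  · have := iterNxt_finiteIndex (Φ := Φ) N i
    infer_instance
  · exact Subgroup.comap_mono (iterNxt_antitone N (Nat.le_succ i))
  · rw [eq_bot_iff]
    intro x hx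
    rw [Subgroup.mem_iInf] at hx
    exact Subtype.ext (hN.eq_one_of_forall_mem hx)
  · rintro x ⟨hx, k, hk, h⟩
    change (x : W) ∈ Φ.iterNxt N (i + 1)
    rw [iterNxt_succ]
    refine ratDer_subset_nxt _ hx hk ?_
    have h1 := Subgroup.mem_map_of_mem N.subtype h
    rw [Subgroup.map_commutator, Subgroup.subgroupOf_map_subtype, inf_eq_left.2 (hle i)] at h1
    simpa using h1

end RootData

/-- Rescaled Chebyshev polynomials of the second kind, shifted to vanish at index `0`. -/
def chebU {R : Type*} [CommRing R] (κ : R) : ℕ → R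
  | 0 => 0
  | 1 => 1
  | n + 2 => κ * chebU κ (n + 1) - chebU κ n

theorem map_chebU {R S : Type*} [CommRing R] [CommRing S] (f : R →+* S) (κ : R) (n : ℕ) :
    f (chebU κ n) = chebU (f κ) n := by
  induction n using Nat.twoStepInduction with
  | zero => simp [chebU]
  | one => simp [chebU]
  | more n h1 h2 => simp [chebU, h1, h2]

theorem chebU_lt_succ {t : ℝ} (ht : 2 ≤ t) (n : ℕ) :
    0 ≤ chebU t n ∧ chebU t n < chebU t (n + 1) := by
  induction n with
  | zero => simp [chebU]
  | succ n ih =>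
    refine ⟨ih.1.trans ih.2.le, ?_⟩
    rw [chebU]
    nlinarith [ih.1, ih.2]

theorem chebU_strictMono {t : ℝ} (ht : 2 ≤ t) : StrictMono (chebU t) :=
  strictMono_nat_of_lt_succ fun n => (chebU_lt_succ ht n).2

theorem chebU_nonneg {t : ℝ} (ht : 2 ≤ t) (n : ℕ) : 0 ≤ chebU t n := (chebU_lt_succ ht n).1

theorem chebU_two_cos_mul_sin (x : ℝ) (n : ℕ) :
    chebU (2 * Real.cos x) n * Real.sin x = Real.sin (n * x) := by
  induction n using Nat.twoStepInduction with
  | zero => simp [chebU]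
  | one => simp [chebU]
  | more n h1 h2 =>
    rw [chebU, sub_mul, mul_assoc, h1, h2]
    have e1 : ((n + 2 : ℕ) : ℝ) * x = (n + 1 : ℕ) * x + x := by push_cast; ring
    have e2 : (n : ℝ) * x = (n + 1 : ℕ) * x - x := by push_cast; ring
    rw [e1, e2, Real.sin_add, Real.sin_sub]
    ring

section PiDiv

variable {m : ℕ} (hm : 2 ≤ m)

include hm

theorem sin_pi_div_pos : 0 < Real.sin (Real.pi / m) := by
  have hm' : (2 : ℝ) ≤ m := by exact_mod_cast hm
  exact Real.sin_pos_of_pos_of_lt_pi (by positivity)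
    (div_lt_self Real.pi_pos (by linarith))

theorem chebU_pi_div_nonneg {j : ℕ} (hj : j ≤ m) : 0 ≤ chebU (2 * Real.cos (Real.pi / m)) j := by
  have hm' : (0 : ℝ) < m := by exact_mod_cast (by omega : 0 < m)
  have hj' : (j : ℝ) ≤ m := by exact_mod_cast hj
  refine nonneg_of_mul_nonneg_left ?_ (sin_pi_div_pos hm)
  rw [chebU_two_cos_mul_sin]
  refine Real.sin_nonneg_of_nonneg_of_le_pi (by positivity) ?_
  rw [mul_div_assoc', div_le_iff₀ hm', mul_comm]
  exact mul_le_mul_of_nonneg_left hj' Real.pi_pos.le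

theorem chebU_pi_div_two_mul : chebU (2 * Real.cos (Real.pi / m)) (2 * m) = 0 := by
  have hm' : (m : ℝ) ≠ 0 := by exact_mod_cast (by omega : m ≠ 0)
  refine (mul_eq_zero.1 ?_).resolve_right (sin_pi_div_pos hm).ne'
  rw [chebU_two_cos_mul_sin]
  have : ((2 * m : ℕ) : ℝ) * (Real.pi / m) = 2 * Real.pi := by push_cast; field_simp
  rw [this, Real.sin_two_pi]

theorem chebU_pi_div_two_mul_add_one :
    chebU (2 * Real.cos (Real.pi / m)) (2 * m + 1) = 1 := by
  have hm' : (m : ℝ) ≠ 0 := by exact_mod_cast (by omega : m ≠ 0)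
  apply mul_right_cancel₀ (sin_pi_div_pos hm).ne'
  rw [chebU_two_cos_mul_sin]
  have : ((2 * m + 1 : ℕ) : ℝ) * (Real.pi / m) = Real.pi / m + 2 * Real.pi := by
    push_cast; field_simp; ring
  rw [this, Real.sin_add_two_pi, one_mul]

end PiDiv

theorem CoxeterMatrix.two_le_of_ne {B : Type*} (M : CoxeterMatrix B) {b c : B} (hbc : b ≠ c)
    (hM : M b c ≠ 0) : 2 ≤ M b c := by
  have : M b c ≠ 1 := M.off_diagonal b c hbc
  omega

/-- Coset decomposition with respect to a dihedral parabolic subgroup. -/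
theorem CoxeterSystem.exists_eq_mul_alternatingWord {B W : Type*} [Group W]
    {M : CoxeterMatrix B} (cs : CoxeterSystem M W) {w : W} {b c : B}
    (hb : ¬ cs.IsRightDescent w b) (hc : cs.IsRightDescent w c) :
    ∃ v j, w = v * cs.wordProd (CoxeterSystem.alternatingWord b c j) ∧
      cs.length v < cs.length w ∧ ¬ cs.IsRightDescent v b ∧ ¬ cs.IsRightDescent v c ∧
      (M b c = 0 ∨ j < M b c) := by
  classical
  have hl : ∀ b c j, cs.length (cs.wordProd (CoxeterSystem.alternatingWord b c j)) ≤ j := by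
    intro b c j
    simpa using cs.length_wordProd_le (CoxeterSystem.alternatingWord b c j)
  let p : ℕ → Prop := fun j =>
    cs.length (w * (cs.wordProd (CoxeterSystem.alternatingWord b c j))⁻¹) + j = cs.length w
  have p1 : p 1 := by
    have := cs.isRightDescent_iff.1 hc
    simpa [p, CoxeterSystem.alternatingWord] using this
  have hw1 : 1 ≤ cs.length w := by
    have := p1; simp only [p] at this; omega
  have hJ : p (Nat.findGreatest p (cs.length w)) := Nat.findGreatest_spec hw1 p1
  have hJ1 : 1 ≤ Nat.findGreatest p (cs.length w) := Nat.le_findGreatest hw1 p1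
  have hmax : ∀ k, Nat.findGreatest p (cs.length w) < k → k ≤ cs.length w → ¬ p k :=
    fun k => Nat.findGreatest_is_greatest
  generalize Nat.findGreatest p (cs.length w) = J at hJ hJ1 hmax
  obtain ⟨v, hv⟩ : ∃ v, w * (cs.wordProd (CoxeterSystem.alternatingWord b c J))⁻¹ = v := ⟨_, rfl⟩
  simp only [p] at hJ hmax
  rw [hv] at hJ
  have hw : w = v * cs.wordProd (CoxeterSystem.alternatingWord b c J) := by
    rw [← hv, inv_mul_cancel_right]
  have next : ¬ cs.IsRightDescent v (if Even J then c else b) := by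
    intro hd
    have hd := cs.isRightDescent_iff.1 hd
    refine hmax (J + 1) (by omega) (by omega) ?_
    have : w * (cs.wordProd (CoxeterSystem.alternatingWord b c (J + 1)))⁻¹ =
        v * cs.simple (if Even J then c else b) := by
      rw [CoxeterSystem.alternatingWord_succ', cs.wordProd_cons, hw]
      simp
    rw [this]; omega
  have prev : ¬ cs.IsRightDescent v (if Even J then b else c) := by
    intro hd
    have hd := cs.isRightDescent_iff.1 hd
    obtain ⟨j, rfl⟩ : ∃ j, J = j + 1 := ⟨J - 1, by omega⟩
    have e : (if Even (j + 1) then b else c) = if Even j then c else b := by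
      by_cases hj : Even j <;> simp [hj, Nat.even_add_one]
    rw [e] at hd
    have : w = v * cs.simple (if Even j then c else b) *
        cs.wordProd (CoxeterSystem.alternatingWord b c j) := by
      rw [hw, CoxeterSystem.alternatingWord_succ', cs.wordProd_cons, mul_assoc]
    have h1 := cs.length_mul_le (v * cs.simple (if Even j then c else b))
        (cs.wordProd (CoxeterSystem.alternatingWord b c j))
    rw [← this] at h1
    have := hl b c j
    omega
  refine ⟨v, J, hw, by omega, ?_, ?_, ?_⟩
  · by_cases hj : Even J
    · simpa [hj] using prev
    · simpa [hj] using next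
  · by_cases hj : Even J
    · simpa [hj] using next
    · simpa [hj] using prev
  · by_contra! hM
    obtain ⟨hM, hJM⟩ := hM
    have h1 := cs.length_mul_le v (cs.wordProd (CoxeterSystem.alternatingWord b c J))
    rw [← hw] at h1
    have h2 := hl b c J
    have hJM' : J = M b c := by
      by_contra hne
      refine cs.not_isReduced_alternatingWord b c hM (m := J) (by omega) ?_
      rw [CoxeterSystem.IsReduced, CoxeterSystem.length_alternatingWord]
      omega
    have h3 : cs.wordProd (CoxeterSystem.alternatingWord b c J) =
        cs.wordProd (CoxeterSystem.alternatingWord c b J) := by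
      have := cs.wordProd_braidWord_eq b c
      rw [CoxeterSystem.braidWord, CoxeterSystem.braidWord, M.symmetric c b, ← hJM'] at this
      exact this
    obtain ⟨j, rfl⟩ : ∃ j, J = j + 1 := ⟨J - 1, by omega⟩
    have h4 : w * cs.simple b = v * cs.wordProd (CoxeterSystem.alternatingWord b c j) := by
      rw [hw, h3, CoxeterSystem.alternatingWord_succ, cs.wordProd_concat]
      simp [mul_assoc]
    have h5 := cs.length_mul_le v (cs.wordProd (CoxeterSystem.alternatingWord b c j))
    rw [← h4] at h5
    have := hl b c j
    have := cs.not_isRightDescent_iff.1 hb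
    omega

namespace GramRep

open Matrix

variable {B R : Type*} [Fintype B] [DecidableEq B] [CommRing R]

/-- The reflection matrix with root `β`, for the bilinear form with Gram matrix `K`. -/
def reflMat (K : Matrix B B R) (β : B → R) : Matrix B B R := 1 - vecMulVec β (K *ᵥ β)

theorem reflMat_mulVec (K : Matrix B B R) (β x : B → R) :
    reflMat K β *ᵥ x = x - toBilin' K x β • β := by
  rw [reflMat, sub_mulVec, one_mulVec, vecMulVec_mulVec, op_smul_eq_smul, toBilin'_apply',
    dotProduct_comm]

theorem toBilin'_comm {K : Matrix B B R} (hK : K.IsSymm) (x y : B → R) :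
    toBilin' K x y = toBilin' K y x := by
  rw [toBilin'_apply', toBilin'_apply', dotProduct_mulVec, dotProduct_comm, ← mulVec_transpose,
    hK.eq]

theorem toBilin'_reflMat {K : Matrix B B R} (hK : K.IsSymm) {β : B → R} (h : toBilin' K β β = 2)
    (x y : B → R) : toBilin' K (reflMat K β *ᵥ x) (reflMat K β *ᵥ y) = toBilin' K x y := by
  simp only [reflMat_mulVec, map_sub, map_smul, LinearMap.sub_apply, LinearMap.smul_apply,
    smul_eq_mul, h, toBilin'_comm hK β y]
  ring

section Dihedral

variable {P Q : Matrix B B R} {β γ : B → R} {κ : R}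

theorem pow_mulVec_left (hPβ : P *ᵥ β = -β) (hPγ : P *ᵥ γ = γ + κ • β) (hQγ : Q *ᵥ γ = -γ)
    (hQβ : Q *ᵥ β = β + κ • γ) (k : ℕ) :
    (P * Q) ^ k *ᵥ β = chebU κ (2 * k + 1) • β + chebU κ (2 * k) • γ := by
  induction k with
  | zero => simp [chebU]
  | succ k ih =>
    rw [pow_succ', ← mulVec_mulVec, ih, ← mulVec_mulVec]
    simp only [mulVec_add, mulVec_smul, hPβ, hPγ, hQβ, hQγ, mulVec_neg, Nat.mul_succ, chebU]
    module

theorem pow_mulVec_right (hPβ : P *ᵥ β = -β) (hPγ : P *ᵥ γ = γ + κ • β) (hQγ : Q *ᵥ γ = -γ)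
    (hQβ : Q *ᵥ β = β + κ • γ) (k : ℕ) : (P * Q) ^ k *ᵥ γ =
      -chebU κ (2 * k) • β + (chebU κ (2 * k + 1) - κ * chebU κ (2 * k)) • γ := by
  induction k with
  | zero => simp [chebU]
  | succ k ih =>
    rw [pow_succ', ← mulVec_mulVec, ih, ← mulVec_mulVec]
    simp only [mulVec_add, mulVec_smul, hPβ, hPγ, hQβ, hQγ, mulVec_neg, Nat.mul_succ, chebU]
    module

end Dihedral

theorem reflMat_mul_pow_eq_one [IsDomain R] {K : Matrix B B R} (hK : K.IsSymm) {β γ : B → R}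
    (hβ : toBilin' K β β = 2) (hγ : toBilin' K γ γ = 2) {κ : R} (hβγ : toBilin' K β γ = -κ)
    (hκ : 4 - κ ^ 2 ≠ 0) {k : ℕ} (h0 : chebU κ (2 * k) = 0) (h1 : chebU κ (2 * k + 1) = 1) :
    (reflMat K β * reflMat K γ) ^ k = 1 := by
  have hγβ : toBilin' K γ β = -κ := by rw [toBilin'_comm hK, hβγ]
  have hPβ : reflMat K β *ᵥ β = -β := by rw [reflMat_mulVec, hβ]; module
  have hQγ : reflMat K γ *ᵥ γ = -γ := by rw [reflMat_mulVec, hγ]; module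
  have hPγ : reflMat K β *ᵥ γ = γ + κ • β := by rw [reflMat_mulVec, hγβ]; module
  have hQβ : reflMat K γ *ᵥ β = β + κ • γ := by rw [reflMat_mulVec, hβγ]; module
  have e1 := pow_mulVec_left hPβ hPγ hQγ hQβ k
  have e2 := pow_mulVec_right hPβ hPγ hQγ hQβ k
  rw [h0, h1] at e1 e2
  have key : ∀ v, (reflMat K β * reflMat K γ) ^ k *ᵥ v = v := by
    intro v
    obtain ⟨x, hx⟩ : ∃ x, toBilin' K v β = x := ⟨_, rfl⟩
    obtain ⟨y, hy⟩ : ∃ y, toBilin' K v γ = y := ⟨_, rfl⟩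
    obtain ⟨u, hu⟩ : ∃ u, u = (4 - κ ^ 2) • v - (2 * x + κ * y) • β - (2 * y + κ * x) • γ :=
      ⟨_, rfl⟩
    have u1 : toBilin' K u β = 0 := by
      simp only [hu, map_sub, map_smul, LinearMap.sub_apply, LinearMap.smul_apply, smul_eq_mul,
        hx, hβ, hγβ]
      ring
    have u2 : toBilin' K u γ = 0 := by
      simp only [hu, map_sub, map_smul, LinearMap.sub_apply, LinearMap.smul_apply, smul_eq_mul,
        hy, hγ, hβγ]
      ring
    have u3 : (reflMat K β * reflMat K γ) *ᵥ u = u := by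
      rw [← mulVec_mulVec, reflMat_mulVec K γ, u2, zero_smul, sub_zero, reflMat_mulVec, u1,
        zero_smul, sub_zero]
    have u4 : (reflMat K β * reflMat K γ) ^ k *ᵥ u = u := by
      clear h0 h1 e1 e2
      induction k with
      | zero => simp
      | succ k ih => rw [pow_succ, ← mulVec_mulVec, u3, ih]
    have hv : (4 - κ ^ 2) • v = u + (2 * x + κ * y) • β + (2 * y + κ * x) • γ := by
      rw [hu]; module
    have := congrArg ((reflMat K β * reflMat K γ) ^ k *ᵥ ·) hv
    simp only [mulVec_add, mulVec_smul, u4, e1, e2] at this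
    apply smul_right_injective (B → R) hκ
    simp only [this, hv]
    module
  apply Matrix.ext_of_mulVec_single
  intro i
  rw [key, one_mulVec]

variable {W : Type*} [Group W] {M : CoxeterMatrix B} {cs : CoxeterSystem M W}

/-- A representation of a Coxeter group by simple reflections of a bilinear form, with a pointed
cone `P` of nonnegative scalars. -/
structure IsGeom (cs : CoxeterSystem M W) (K : Matrix B B R) (P : Subsemiring R)
    (ρ : W →* Matrix B B R) : Prop where
  symm : K.IsSymm
  diag : ∀ b, K b b = 2
  simple : ∀ b, ρ (cs.simple b) = reflMat K (Pi.single b 1)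
  chebU_mem : ∀ b c, b ≠ c → ∀ j, (M b c = 0 ∨ j ≤ M b c) → chebU (-K b c) j ∈ P
  pointed : ∀ x ∈ P, -x ∈ P → x = 0

theorem inv_mulVec_mulVec (ρ : W →* Matrix B B R) (w : W) (x : B → R) :
    ρ w⁻¹ *ᵥ (ρ w *ᵥ x) = x := by
  rw [mulVec_mulVec, ← map_mul, inv_mul_cancel, map_one, one_mulVec]

theorem mulVec_inv_mulVec (ρ : W →* Matrix B B R) (w : W) (x : B → R) :
    ρ w *ᵥ (ρ w⁻¹ *ᵥ x) = x := by
  rw [mulVec_mulVec, ← map_mul, mul_inv_cancel, map_one, one_mulVec]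

/-- The action on column vectors given by a matrix representation. -/
abbrev vecAction (ρ : W →* Matrix B B R) : DistribMulAction W (B → R) where
  smul w v := ρ w *ᵥ v
  one_smul v := by change ρ 1 *ᵥ v = v; rw [map_one, one_mulVec]
  mul_smul w w' v := by change ρ _ *ᵥ v = ρ w *ᵥ (ρ w' *ᵥ v); rw [map_mul, mulVec_mulVec]
  smul_zero w := mulVec_zero _
  smul_add w := mulVec_add _

namespace IsGeom

variable {K : Matrix B B R} {P : Subsemiring R} {ρ : W →* Matrix B B R} (h : IsGeom cs K P ρ)

omit [DecidableEq B] in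
theorem sum_map_nonneg {ev : R →+* ℝ} (hev : ∀ x ∈ P, 0 ≤ ev x) {x : B → R} (hx : ∀ i, x i ∈ P) :
    0 ≤ ∑ i, ev (x i) :=
  Finset.sum_nonneg fun i _ => hev _ (hx i)

theorem sum_map_pos {ev : R →+* ℝ} (hev : ∀ x ∈ P, 0 ≤ ev x) {w : W} {b : B}
    (hx : ∀ i, (ρ w *ᵥ Pi.single b 1) i ∈ P) : 0 < ∑ i, ev ((ρ w *ᵥ Pi.single b 1) i) := by
  refine lt_of_le_of_ne (sum_map_nonneg hev hx) fun h0 => ?_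
  rw [eq_comm, Finset.sum_eq_zero_iff_of_nonneg fun i _ => hev _ (hx i)] at h0
  have h1 := congrFun (inv_mulVec_mulVec ρ w (Pi.single b 1)) b
  have h2 := congrArg ev h1
  rw [mulVec, dotProduct, map_sum, Finset.sum_eq_zero] at h2
  · simp at h2
  · intro i _
    rw [map_mul, h0 i (Finset.mem_univ i), mul_zero]

include h

theorem simple_mulVec (b : B) (x : B → R) :
    ρ (cs.simple b) *ᵥ x = x - toBilin' K x (Pi.single b 1) • Pi.single b 1 := by
  rw [h.simple, reflMat_mulVec]

theorem simple_mulVec_self (b : B) :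
    ρ (cs.simple b) *ᵥ Pi.single b 1 = -Pi.single b 1 := by
  rw [h.simple_mulVec, toBilin'_single, h.diag]; module

theorem simple_mulVec_single (b c : B) :
    ρ (cs.simple b) *ᵥ Pi.single c 1 = Pi.single c 1 + (-K b c) • Pi.single b 1 := by
  rw [h.simple_mulVec, toBilin'_single, h.symm.apply]; module

theorem alternatingWord_mulVec (b c : B) (j : ℕ) :
    ρ (cs.wordProd (CoxeterSystem.alternatingWord b c j)) *ᵥ Pi.single b 1 =
      if Even j then chebU (-K b c) (j + 1) • Pi.single b 1 + chebU (-K b c) j • Pi.single c 1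
      else chebU (-K b c) j • Pi.single b 1 + chebU (-K b c) (j + 1) • Pi.single c 1 := by
  induction j with
  | zero =>
    rw [CoxeterSystem.alternatingWord, cs.wordProd_nil, map_one, one_mulVec]
    simp [chebU]
  | succ j ih =>
    rw [CoxeterSystem.alternatingWord_succ', cs.wordProd_cons, map_mul, ← mulVec_mulVec, ih]
    have hcb : K c b = K b c := h.symm.apply _ _
    by_cases hj : Even j
    · have hj' : ¬ Even (j + 1) := by simpa [Nat.even_add_one] using hj
      simp only [hj, hj', if_true, if_false, mulVec_add, mulVec_smul, h.simple_mulVec_self,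
        h.simple_mulVec_single, chebU, hcb]
      module
    · have hj' : Even (j + 1) := by simpa [Nat.even_add_one] using hj
      simp only [hj, hj', if_true, if_false, mulVec_add, mulVec_smul, h.simple_mulVec_self,
        h.simple_mulVec_single, chebU]
      module

/-- Simple roots that are not descents are sent to nonnegative combinations of simple roots. -/
theorem mulVec_single_mem {w : W} {b : B} (hb : ¬ cs.IsRightDescent w b) (i : B) :
    (ρ w *ᵥ Pi.single b 1) i ∈ P := by
  induction hn : cs.length w using Nat.strong_induction_on generalizing w b with
  | _ n ih =>
    by_cases hw : w = 1
    · rw [hw, map_one, one_mulVec]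
      by_cases hi : i = b
      · subst hi; simp
      · simp [hi]
    obtain ⟨c, hc⟩ := cs.exists_rightDescent_of_ne_one hw
    have hbc : b ≠ c := by rintro rfl; exact hb hc
    obtain ⟨v, j, rfl, hlt, h1, h2, h3⟩ := cs.exists_eq_mul_alternatingWord hb hc
    have m1 := ih _ (hn ▸ hlt) h1 rfl
    have m2 := ih _ (hn ▸ hlt) h2 rfl
    have c1 := h.chebU_mem b c hbc j (h3.imp_right fun h => h.le)
    have c2 := h.chebU_mem b c hbc (j + 1) h3
    rw [map_mul, ← mulVec_mulVec, h.alternatingWord_mulVec]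
    split_ifs <;> rw [mulVec_add, mulVec_smul, mulVec_smul] <;>
      exact P.add_mem (P.mul_mem ‹_› m1) (P.mul_mem ‹_› m2)

theorem mul_simple_mulVec (w : W) (b : B) :
    ρ (w * cs.simple b) *ᵥ Pi.single b 1 = -(ρ w *ᵥ Pi.single b 1) := by
  rw [map_mul, ← mulVec_mulVec, h.simple_mulVec_self, mulVec_neg]

theorem neg_mulVec_single_mem {w : W} {b : B} (hb : cs.IsRightDescent w b) (i : B) :
    (-(ρ w *ᵥ Pi.single b 1)) i ∈ P := by
  rw [← h.mul_simple_mulVec]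
  exact h.mulVec_single_mem (cs.isRightDescent_iff_not_isRightDescent_mul.1 hb) i

theorem eq_one_of_map_eq_one [Nontrivial R] {w : W} (hw : ρ w = 1) : w = 1 := by
  by_contra hne
  obtain ⟨b, hb⟩ := cs.exists_rightDescent_of_ne_one hne
  have := h.neg_mulVec_single_mem hb b
  rw [hw, one_mulVec] at this
  exact one_ne_zero (h.pointed 1 P.one_mem (by simpa using this))

theorem injective [Nontrivial R] : Function.Injective ρ :=
  (injective_iff_map_eq_one ρ).2 fun _ => h.eq_one_of_map_eq_one

theorem toBilin'_mulVec (w : W) (x y : B → R) :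
    toBilin' K (ρ w *ᵥ x) (ρ w *ᵥ y) = toBilin' K x y := by
  induction w using cs.simple_induction_left with
  | one => simp
  | mul_simple_left w b ih =>
    rw [map_mul, ← mulVec_mulVec, ← mulVec_mulVec, h.simple,
      toBilin'_reflMat h.symm (by rw [toBilin'_single, h.diag]), ih]

theorem toBilin'_mulVec_right (w : W) (x y : B → R) :
    toBilin' K x (ρ w *ᵥ y) = toBilin' K (ρ w⁻¹ *ᵥ x) y := by
  rw [← h.toBilin'_mulVec w (ρ w⁻¹ *ᵥ x), mulVec_inv_mulVec]

theorem map_conj_simple (w : W) (b : B) :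
    ρ (w * cs.simple b * w⁻¹) = reflMat K (ρ w *ᵥ Pi.single b 1) := by
  apply Matrix.ext_of_mulVec_single
  intro i
  rw [map_mul, map_mul, ← mulVec_mulVec, ← mulVec_mulVec, h.simple, reflMat_mulVec, mulVec_sub,
    mulVec_smul, mulVec_inv_mulVec, ← h.toBilin'_mulVec_right, reflMat_mulVec]

theorem eq_single_of_mem [IsDomain R] [CharZero R] {w : W} {b c : B}
    (hw : ∀ i, (ρ w *ᵥ Pi.single b 1) i ∈ P)
    (hcw : ∀ i, (-(ρ (cs.simple c) *ᵥ (ρ w *ᵥ Pi.single b 1))) i ∈ P) :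
    ρ w *ᵥ Pi.single b 1 = Pi.single c 1 := by
  have hn := h.toBilin'_mulVec w (Pi.single b 1) (Pi.single b 1)
  rw [toBilin'_single, h.diag] at hn
  generalize ρ w *ᵥ Pi.single b 1 = v at hw hcw hn
  have hv : v = v c • Pi.single c 1 := by
    ext i
    by_cases hi : i = c
    · subst hi; simp
    · have := hcw i
      rw [h.simple_mulVec] at this
      simp only [Pi.neg_apply, Pi.sub_apply, Pi.smul_apply, Pi.single_eq_of_ne hi, smul_zero,
        sub_zero] at this
      simpa [hi] using h.pointed _ (hw i) this
  rw [hv, map_smul, map_smul, LinearMap.smul_apply, toBilin'_single, h.diag] at hn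
  have h2 : (2 : R) ≠ 0 := two_ne_zero
  have h3 : (v c) ^ 2 = 1 := by
    apply mul_left_cancel₀ h2
    simp only [smul_eq_mul] at hn
    linear_combination hn
  rcases sq_eq_one_iff.1 h3 with h4 | h4
  · rw [hv, h4, one_smul]
  · have := hw c
    rw [h4] at this
    exact absurd (h.pointed 1 P.one_mem this) one_ne_zero

/-- The root data of a geometric representation. -/
def rootData [IsDomain R] [CharZero R] :
    letI := vecAction ρ
    RootData cs (B → R) :=
  letI := vecAction ρ
  { root := fun b => Pi.single b 1
    pos := fun v => ∀ i, v i ∈ P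
    pos_root := fun b i => by
      have := h.mulVec_single_mem (cs.not_isRightDescent_one b) i
      rwa [map_one, one_mulVec] at this
    pos_or := fun w b => by
      by_cases hb : cs.IsRightDescent w b
      · exact Or.inr (h.neg_mulVec_single_mem hb)
      · exact Or.inl (h.mulVec_single_mem hb)
    not_pos_neg := fun w b h1 h2 => by
      have : ρ w *ᵥ Pi.single b 1 = 0 := funext fun i => h.pointed _ (h1 i) (h2 i)
      have h3 := inv_mulVec_mulVec ρ w (Pi.single b 1)
      rw [this, mulVec_zero] at h3
      simpa using congrFun h3 b
    simple_smul_root := fun b => h.simple_mulVec_self b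
    pos_simple_smul := fun w b c h1 h2 => by
      by_cases hb : cs.IsRightDescent (cs.simple c * w) b
      · refine absurd (h.eq_single_of_mem h1 fun i => ?_) h2
        rw [mulVec_mulVec, ← map_mul]
        exact h.neg_mulVec_single_mem hb i
      · intro i
        have := h.mulVec_single_mem hb i
        rw [map_mul, ← mulVec_mulVec] at this
        exact this
    reflection_eq := fun w b v c hwv => by
      apply h.injective
      rw [h.map_conj_simple, h.map_conj_simple]
      exact congrArg _ hwv }

theorem conj_mul_conj_pow_mulVec (v w : W) (b c : B) (k : ℕ) {κ : R}
    (hκ : toBilin' K (ρ v *ᵥ Pi.single b 1) (ρ w *ᵥ Pi.single c 1) = -κ) :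
    ρ ((v * cs.simple b * v⁻¹ * (w * cs.simple c * w⁻¹)) ^ k * v) *ᵥ Pi.single b 1 =
      chebU κ (2 * k + 1) • (ρ v *ᵥ Pi.single b 1) +
        chebU κ (2 * k) • (ρ w *ᵥ Pi.single c 1) := by
  have hβ : toBilin' K (ρ v *ᵥ Pi.single b 1) (ρ v *ᵥ Pi.single b 1) = 2 := by
    rw [h.toBilin'_mulVec, toBilin'_single, h.diag]
  have hγ : toBilin' K (ρ w *ᵥ Pi.single c 1) (ρ w *ᵥ Pi.single c 1) = 2 := by
    rw [h.toBilin'_mulVec, toBilin'_single, h.diag]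
  have hκ' := hκ
  rw [toBilin'_comm h.symm] at hκ'
  rw [map_mul, map_pow, map_mul, h.map_conj_simple, h.map_conj_simple, ← mulVec_mulVec]
  apply pow_mulVec_left <;> rw [reflMat_mulVec]
  · rw [hβ]; module
  · rw [hκ']; module
  · rw [hγ]; module
  · rw [hκ]; module

/-- Two roots whose product is at most `-2` under some positive evaluation cannot be separated
from both of their negatives. -/
theorem not_pos_of_le_neg_two [IsDomain R] [CharZero R] {ev : R →+* ℝ} (hev : ∀ x ∈ P, 0 ≤ ev x)
    {v w : W} {b c : B}
    (hle : ev (toBilin' K (ρ v *ᵥ Pi.single b 1) (ρ w *ᵥ Pi.single c 1)) ≤ -2)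
    {g g' : W} (h1 : ∀ i, (ρ (g * v) *ᵥ Pi.single b 1) i ∈ P)
    (h2 : ∀ i, (ρ (g * w) *ᵥ Pi.single c 1) i ∈ P)
    (h3 : ∀ i, (-(ρ (g' * v) *ᵥ Pi.single b 1)) i ∈ P)
    (h4 : ∀ i, (-(ρ (g' * w) *ᵥ Pi.single c 1)) i ∈ P) : False := by
  let := vecAction ρ
  let Φ := h.rootData
  obtain ⟨κ, hκ⟩ : ∃ κ, toBilin' K (ρ v *ᵥ Pi.single b 1) (ρ w *ᵥ Pi.single c 1) = -κ :=
    ⟨_, (neg_neg _).symm⟩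
  rw [hκ, map_neg, neg_le_neg_iff] at hle
  let r : W := v * cs.simple b * v⁻¹ * (w * cs.simple c * w⁻¹)
  have hr : ∀ (x : W) (k : ℕ), ρ (x * (r ^ k * v)) *ᵥ Pi.single b 1 =
      chebU κ (2 * k + 1) • (ρ (x * v) *ᵥ Pi.single b 1) +
        chebU κ (2 * k) • (ρ (x * w) *ᵥ Pi.single c 1) := by
    intro x k
    rw [map_mul, ← mulVec_mulVec, h.conj_mul_conj_pow_mulVec v w b c k hκ, mulVec_add, mulVec_smul,
      mulVec_smul, map_mul, map_mul, mulVec_mulVec, mulVec_mulVec]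
  have hs : ∀ (x : W) (k : ℕ), ∑ i, ev ((ρ (x * (r ^ k * v)) *ᵥ Pi.single b 1) i) =
      chebU (ev κ) (2 * k + 1) * ∑ i, ev ((ρ (x * v) *ᵥ Pi.single b 1) i) +
        chebU (ev κ) (2 * k) * ∑ i, ev ((ρ (x * w) *ᵥ Pi.single c 1) i) := by
    intro x k
    rw [hr]
    simp only [Pi.add_apply, Pi.smul_apply, smul_eq_mul, map_add, map_mul, map_chebU,
      Finset.sum_add_distrib, Finset.mul_sum]
  have p1 := sum_map_pos hev h1
  have p2 := sum_map_pos hev h2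
  have n1 := sum_map_pos (ρ := ρ) (w := g' * v * cs.simple b) (b := b) hev
    (by rwa [h.mul_simple_mulVec])
  have n2 := sum_map_pos (ρ := ρ) (w := g' * w * cs.simple c) (b := c) hev
    (by rwa [h.mul_simple_mulVec])
  simp only [h.mul_simple_mulVec, Pi.neg_apply, map_neg, Finset.sum_neg_distrib] at n1 n2
  have hodd : ∀ k, 0 < chebU (ev κ) (2 * k + 1) := fun k =>
    (chebU_nonneg hle _).trans_lt (chebU_lt_succ hle (2 * k)).2
  have heven : ∀ k, 0 ≤ chebU (ev κ) (2 * k) := fun k => chebU_nonneg hle _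
  let f : ℕ → B → R := fun k => ρ (g * (r ^ k * v)) *ᵥ Pi.single b 1
  have hf : Function.Injective f := by
    have : StrictMono fun k => ∑ i, ev (f k i) := by
      intro k l hkl
      simp only [f, hs]
      exact add_lt_add
        ((mul_lt_mul_iff_left₀ p1).2 (chebU_strictMono hle (by omega)))
        ((mul_lt_mul_iff_left₀ p2).2 (chebU_strictMono hle (by omega)))
    exact fun k l hkl => this.injective (by simp only [hkl])
  refine Set.infinite_of_injective_forall_mem hf (fun k => ?_) (Φ.signChange_finite (g * g'⁻¹))
  have e1 : Φ.pos (f k) := by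
    refine (Φ.pos_or (g * (r ^ k * v)) b).resolve_right fun hn => ?_
    have := sum_map_nonneg hev hn
    have hp : 0 < ∑ i, ev (f k i) := by
      simp only [f, hs]
      exact add_pos_of_pos_of_nonneg (mul_pos (hodd k) p1) (mul_nonneg (heven k) p2.le)
    have e : ∑ i, ev ((-((g * (r ^ k * v)) • Φ.root b)) i) = -∑ i, ev (f k i) := by
      rw [← Finset.sum_neg_distrib]
      exact Finset.sum_congr rfl fun i _ => by rw [Pi.neg_apply, map_neg]; rfl
    rw [e] at this
    linarith
  have e2 : (g * g'⁻¹)⁻¹ • f k = ρ (g' * (r ^ k * v)) *ᵥ Pi.single b 1 := by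
    change ρ _ *ᵥ (ρ _ *ᵥ _) = _
    rw [mulVec_mulVec, ← map_mul]
    simp [mul_assoc]
  have e3 : ¬ Φ.pos ((g * g'⁻¹)⁻¹ • f k) := by
    rw [e2]
    intro hp
    have := sum_map_nonneg hev hp
    rw [hs] at this
    nlinarith [mul_pos (hodd k) n1, mul_nonneg (heven k) n2.le]
  have e4 : Φ.IsRoot (f k) := ⟨g * (r ^ k * v), b, rfl⟩
  rw [Function.mem_support, RootData.signChange, if_pos e4, if_pos e1, if_neg e3]
  norm_num

theorem abs_lt_two_of_cross [IsDomain R] [CharZero R] {ev : R →+* ℝ} (hev : ∀ x ∈ P, 0 ≤ ev x)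
    {w : W} {b c : B} (hc : letI := vecAction ρ
      h.rootData.Cross (Pi.single b 1) (ρ w *ᵥ Pi.single c 1)) :
    |ev (toBilin' K (Pi.single b 1) (ρ w *ᵥ Pi.single c 1))| < 2 := by
  obtain ⟨⟨g1, a1, b1⟩, ⟨g2, a2, b2⟩, ⟨g3, a3, b3⟩, ⟨g4, a4, b4⟩⟩ := hc
  change ∀ i, (ρ _ *ᵥ _) i ∈ P at a1 a2
  change ∀ i, (ρ _ *ᵥ (ρ _ *ᵥ _)) i ∈ P at b1 b3
  change ∀ i, (-(ρ _ *ᵥ _)) i ∈ P at a3 a4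
  change ∀ i, (-(ρ _ *ᵥ (ρ _ *ᵥ _))) i ∈ P at b2 b4
  rw [mulVec_mulVec, ← map_mul] at b1 b2 b3 b4
  by_contra! hle
  rcases le_abs.1 hle with hle | hle
  · refine h.not_pos_of_le_neg_two hev (v := 1) (w := w * cs.simple c) (b := b) (c := c)
      (g := g2) (g' := g3) ?_ ?_ ?_ ?_ ?_
    · rw [h.mul_simple_mulVec, map_one, one_mulVec, map_neg, map_neg]
      linarith
    · rwa [mul_one]
    · rwa [← mul_assoc, h.mul_simple_mulVec]
    · rwa [mul_one]
    · rwa [← mul_assoc, h.mul_simple_mulVec, neg_neg]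
  · refine h.not_pos_of_le_neg_two hev (v := 1) (w := w) (b := b) (c := c)
      (g := g1) (g' := g4) ?_ ?_ b1 ?_ b4
    · rw [map_one, one_mulVec]
      linarith
    · rwa [mul_one]
    · rwa [mul_one]

end IsGeom

section Polynomial

open Polynomial

/-- The polynomials with coefficients in `A` that are nonnegative on `[2, ∞)` under a
homomorphism from `A` to the reals. -/
def cone {A : Type*} [CommRing A] (θ : A →+* ℝ) : Subsemiring A[X] where
  carrier := {f | ∀ t, 2 ≤ t → 0 ≤ eval₂RingHom θ t f}
  zero_mem' t _ := by rw [map_zero]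
  one_mem' t _ := by rw [map_one]; exact zero_le_one
  add_mem' hf hg t ht := by rw [map_add]; exact add_nonneg (hf t ht) (hg t ht)
  mul_mem' hf hg t ht := by rw [map_mul]; exact mul_nonneg (hf t ht) (hg t ht)

variable {B A W : Type*} [Fintype B] [DecidableEq B] [CommRing A] [IsDomain A] [Group W]
  {M : CoxeterMatrix B}

/-- The Gram matrix of a Coxeter matrix, where the indeterminate replaces the entries for
products of infinite order. -/
noncomputable def gram (M : CoxeterMatrix B) (κ : B → B → A) : Matrix B B A[X] :=
  of fun b c => if M b c = 0 then -X else -C (κ b c)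

variable {κ : B → B → A} {θ : A →+* ℝ}

omit [Fintype B] [DecidableEq B] [IsDomain A] in
theorem gram_isSymm (hθ : Function.Injective θ)
    (hκ : ∀ b c, θ (κ b c) = 2 * Real.cos (Real.pi / M b c)) : (gram M κ).IsSymm := by
  ext b c
  have : κ b c = κ c b := hθ (by rw [hκ, hκ, M.symmetric])
  have h2 : M b c = M c b := M.symmetric b c
  simp only [gram, transpose_apply, of_apply, this, h2]

omit [Fintype B] [DecidableEq B] [IsDomain A] in
theorem gram_diag (hθ : Function.Injective θ)
    (hκ : ∀ b c, θ (κ b c) = 2 * Real.cos (Real.pi / M b c)) (b : B) : gram M κ b b = 2 := by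
  have h1 : M b b = 1 := M.diagonal b
  have : κ b b = -2 := hθ (by rw [hκ, h1]; simp [map_ofNat])
  rw [gram, of_apply, h1, if_neg one_ne_zero, this, C_neg, neg_neg]
  rfl

omit [IsDomain A] in
theorem four_sub_C_sq_ne_zero {m : ℕ} (hm : 2 ≤ m) {a : A}
    (ha : θ a = 2 * Real.cos (Real.pi / m)) : (4 - C a ^ 2 : A[X]) ≠ 0 := by
  intro h0
  have h1 : C (4 - a ^ 2) = C 0 := by rw [C_0, ← h0, C_sub, C_pow]; rfl
  have h2 := congrArg θ (C_injective h1)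
  rw [map_sub, map_pow, ha, map_zero, map_ofNat] at h2
  have := Real.sin_sq_add_cos_sq (Real.pi / m)
  have := sin_pi_div_pos hm
  nlinarith

theorem isLiftable_reflMat (hθ : Function.Injective θ)
    (hκ : ∀ b c, θ (κ b c) = 2 * Real.cos (Real.pi / M b c)) :
    M.IsLiftable fun b => reflMat (gram M κ) (Pi.single b 1) := by
  have hs := gram_isSymm hθ hκ
  have hd := gram_diag hθ hκ
  have hd' : ∀ b, toBilin' (gram M κ) (Pi.single b 1) (Pi.single b 1) = 2 := fun b => by
    rw [toBilin'_single, hd]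
  intro b c
  by_cases hM : M b c = 0
  · rw [hM, pow_zero]
  by_cases hbc : b = c
  · subst hbc
    have h1 : M b b = 1 := M.diagonal b
    rw [h1, pow_one]
    apply Matrix.ext_of_mulVec_single
    intro i
    rw [← mulVec_mulVec, reflMat_mulVec, reflMat_mulVec, map_sub, map_smul, LinearMap.sub_apply,
      LinearMap.smul_apply, hd', one_mulVec, smul_eq_mul]
    module
  · have hm := M.two_le_of_ne hbc hM
    refine reflMat_mul_pow_eq_one hs (hd' b) (hd' c) (κ := C (κ b c)) ?_ ?_ ?_ ?_
    · rw [toBilin'_single, gram, of_apply, if_neg hM]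
    · exact four_sub_C_sq_ne_zero hm (hκ b c)
    · rw [← map_chebU, ← map_zero C]
      congr 1
      apply hθ
      rw [map_chebU, hκ, map_zero, chebU_pi_div_two_mul hm]
    · rw [← map_chebU, ← map_one C]
      congr 1
      apply hθ
      rw [map_chebU, hκ, map_one, chebU_pi_div_two_mul_add_one hm]

omit [IsDomain A] in
theorem eq_zero_of_eval_eq_zero (hθ : Function.Injective θ) {f : A[X]}
    (h : ∀ t, 2 ≤ t → eval₂RingHom θ t f = 0) : f = 0 := by
  refine (Polynomial.map_eq_zero_iff hθ).1 (eq_zero_of_infinite_isRoot _ ?_)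
  refine (Set.Ici_infinite (2 : ℝ)).mono fun t ht => ?_
  have := h t ht
  rwa [coe_eval₂RingHom, ← eval_map] at this

/-- The geometric representation over the polynomial ring. -/
noncomputable def geomRep (cs : CoxeterSystem M W) (hθ : Function.Injective θ)
    (hκ : ∀ b c, θ (κ b c) = 2 * Real.cos (Real.pi / M b c)) : W →* Matrix B B A[X] :=
  cs.lift ⟨fun b => reflMat (gram M κ) (Pi.single b 1), isLiftable_reflMat hθ hκ⟩

theorem isGeom_geomRep (cs : CoxeterSystem M W) (hθ : Function.Injective θ)
    (hκ : ∀ b c, θ (κ b c) = 2 * Real.cos (Real.pi / M b c)) :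
    IsGeom cs (gram M κ) (cone θ) (geomRep cs hθ hκ) where
  symm := gram_isSymm hθ hκ
  diag := gram_diag hθ hκ
  simple b := cs.lift_apply_simple _ b
  chebU_mem b c hbc j hj t ht := by
    rw [map_chebU, gram, of_apply]
    split_ifs with hM
    · rw [neg_neg, coe_eval₂RingHom, eval₂_X]
      exact chebU_nonneg ht j
    · rw [neg_neg, coe_eval₂RingHom, eval₂_C, hκ]
      exact chebU_pi_div_nonneg (M.two_le_of_ne hbc hM) (hj.resolve_left hM)
  pointed f h1 h2 := by
    refine eq_zero_of_eval_eq_zero hθ fun t ht => ?_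
    have a1 := h1 t ht
    have a2 := h2 t ht
    rw [map_neg] at a2
    linarith

end Polynomial

section Reduction

open Polynomial

/-- The reduction of polynomials modulo an ideal of coefficients and the square of the
indeterminate. -/
noncomputable def toDual {A : Type*} [CommRing A] (I : Ideal A) : A[X] →+* DualNumber (A ⧸ I) :=
  eval₂RingHom ((TrivSqZeroExt.inlHom (A ⧸ I) (A ⧸ I)).comp (Ideal.Quotient.mk I)) DualNumber.eps

variable {A : Type*} [CommRing A] {I : Ideal A}

theorem toDual_X : toDual I X = DualNumber.eps := by
  rw [toDual, coe_eval₂RingHom, eval₂_X]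

theorem snd_toDual_C (a : A) : (toDual I (C a)).snd = 0 := by
  rw [toDual, coe_eval₂RingHom, eval₂_C]; rfl

theorem fst_toDual_C (a : A) : (toDual I (C a)).fst = Ideal.Quotient.mk I a := by
  rw [toDual, coe_eval₂RingHom, eval₂_C]; rfl

theorem mem_of_toDual_C_eq_zero {a : A} (h : toDual I (C a) = 0) : a ∈ I := by
  rw [← Ideal.Quotient.eq_zero_iff_mem, ← fst_toDual_C, h]; rfl

theorem mem_of_toDual_C_eq_one {a : A} (h : toDual I (C a) = 1) : a - 1 ∈ I := by
  rw [← Ideal.Quotient.eq, ← fst_toDual_C, h, map_one]; rfl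

theorem eq_top_of_snd_toDual_X (h : (toDual I X).snd = 0) : (1 : A) ∈ I := by
  rw [toDual_X, DualNumber.snd_eps] at h
  rwa [← Ideal.Quotient.eq_zero_iff_mem, map_one]

variable {A : Type*} [CommRing A] {θ : A →+* ℝ}

theorem exists_eq_C_of_abs_lt (hθ : Function.Injective θ) {f : A[X]} {r : ℝ}
    (hf : ∀ t, 2 ≤ t → |eval₂RingHom θ t f| < r) : ∃ a, f = C a := by
  have : (f.map θ).degree ≤ 0 := by
    rw [← Polynomial.isBoundedUnder_abs_atTop_iff]
    refine ⟨r, Filter.eventually_map.2 ?_⟩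
    filter_upwards [Filter.eventually_ge_atTop 2] with t ht
    have := hf t ht
    rw [coe_eval₂RingHom, ← eval_map] at this
    exact this.le
  rw [degree_map_eq_of_injective hθ] at this
  exact ⟨_, eq_C_of_degree_le_zero this⟩

variable {B W : Type*} [Fintype B] [DecidableEq B] [IsDomain A] [CharZero A] [Group W]
  {M : CoxeterMatrix B} {cs : CoxeterSystem M W} {κ : B → B → A}

theorem isGood (hθ : Function.Injective θ)
    (hκ : ∀ b c, θ (κ b c) = 2 * Real.cos (Real.pi / M b c)) {I : Ideal A} {N : Subgroup W}
    (hN : ∀ n ∈ N, (toDual I).mapMatrix (geomRep cs hθ hκ n) = 1) (hp : N ≤ cs.lengthParity.ker)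
    (h1 : (1 : A) ∉ I) (h2 : (2 : A) ∉ I)
    (h3 : ∀ b c, ∀ k < M b c, chebU (κ b c) (2 * k) ∈ I → chebU (κ b c) (2 * k) = 0)
    (h4 : ∀ b c, ∀ k < M b c, chebU (κ b c) (2 * k + 1) - 1 ∈ I →
      chebU (κ b c) (2 * k + 1) - 1 = 0) :
    letI := vecAction (geomRep cs hθ hκ)
    (isGeom_geomRep cs hθ hκ).rootData.IsGood N := by
  have h := isGeom_geomRep cs hθ hκ
  set ρ := geomRep cs hθ hκ
  have key : ∀ n ∈ N, ∀ x i, toDual I ((ρ n *ᵥ x) i) = toDual I (x i) := by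
    intro n hn x i
    have := congrFun (congrArg (· *ᵥ (toDual I ∘ x)) (hN n hn)) i
    rw [RingHom.map_mulVec]
    simpa using this
  have bil : ∀ u x y, (∀ i, toDual I (x i) = toDual I (y i)) →
      toDual I (toBilin' (gram M κ) u x) = toDual I (toBilin' (gram M κ) u y) := by
    intro u x y hxy
    simp only [toBilin'_apply', dotProduct, map_sum, map_mul, mulVec, hxy]
  have hX : ∀ {b c}, M b c = 0 → gram M κ b c = -X := fun hM => by rw [gram, of_apply, if_pos hM]
  have hne : ∀ {b c}, M b c = 0 → b ≠ c := by
    rintro b _ hM rfl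
    exact one_ne_zero ((M.diagonal b).symm.trans hM)
  let := vecAction ρ
  refine RootData.IsGood.mk (Φ := h.rootData) ?_ hp ?_ ?_ ?_
  · intro n hn b hb
    have e : ρ n *ᵥ Pi.single b 1 = -Pi.single b 1 := hb
    have := key n hn (Pi.single b 1) b
    rw [e, Pi.neg_apply, Pi.single_eq_same, map_neg, map_one] at this
    refine h2 (mem_of_toDual_C_eq_zero ?_)
    have h2' : (C (2 : A) : A[X]) = 1 + 1 := by rw [← one_add_one_eq_two, C_add, C_1]
    rw [h2', map_add, map_one]
    nth_rewrite 1 [← this]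
    rw [neg_add_cancel]
  · intro b c hM n hn hc
    obtain ⟨a, ha⟩ := exists_eq_C_of_abs_lt hθ (r := 2) fun t ht =>
      h.abs_lt_two_of_cross (ev := eval₂RingHom θ t) (fun x hx => hx t ht) hc
    have e : toDual I (toBilin' (gram M κ) (Pi.single b 1) (ρ n *ᵥ Pi.single c 1)) =
        toDual I (-X) := by
      rw [← hX hM, ← toBilin'_single (gram M κ) b c]
      exact bil _ _ _ (key n hn _)
    rw [ha] at e
    refine h1 (eq_top_of_snd_toDual_X ?_)
    have := congrArg TrivSqZeroExt.snd e
    rw [snd_toDual_C, map_neg, TrivSqZeroExt.snd_neg] at this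
    rw [← neg_eq_zero, ← this]
  · intro b c hM hn
    have := key _ hn (Pi.single c 1) b
    rw [h.mul_simple_mulVec, h.simple_mulVec_single, hX hM, neg_neg, Pi.neg_apply, Pi.add_apply,
      Pi.single_eq_of_ne (hne hM), Pi.smul_apply, Pi.single_eq_same, zero_add, smul_eq_mul,
      mul_one, map_neg, map_zero] at this
    refine h1 (eq_top_of_snd_toDual_X ?_)
    rw [neg_eq_zero.1 this]; rfl
  · intro b c hM k hk
    by_cases hbc : b = c
    · subst hbc
      rw [cs.simple_mul_simple_self, one_pow]
    have hr : (cs.simple b * cs.simple c) ^ k = (cs.simple b * cs.simple c) ^ (k % M b c) :=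
      pow_eq_pow_mod k (cs.simple_mul_simple_pow b c)
    rw [hr] at hk ⊢
    have hlt : k % M b c < M b c := Nat.mod_lt _ (Nat.pos_of_ne_zero hM)
    generalize k % M b c = l at hk hlt
    have hs := h.symm
    have hm := M.two_le_of_ne hbc hM
    have hK : gram M κ b c = -C (κ b c) := by rw [gram, of_apply, if_neg hM]
    have hK' : gram M κ c b = -C (κ b c) := by rw [hs.apply, hK]
    have e : ρ ((cs.simple b * cs.simple c) ^ l) *ᵥ Pi.single b 1 =
        chebU (C (κ b c)) (2 * l + 1) • Pi.single b 1 +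
          chebU (C (κ b c)) (2 * l) • Pi.single c 1 := by
      rw [map_pow, map_mul]
      apply pow_mulVec_left
      · exact h.simple_mulVec_self b
      · rw [h.simple_mulVec_single, hK, neg_neg]
      · exact h.simple_mulVec_self c
      · rw [h.simple_mulVec_single, hK', neg_neg]
    have eb := key _ hk (Pi.single b 1) b
    have ec := key _ hk (Pi.single b 1) c
    rw [e, ← map_chebU, ← map_chebU] at eb ec
    simp only [Pi.add_apply, Pi.smul_apply, Pi.single_eq_same, Pi.single_eq_of_ne hbc,
      Pi.single_eq_of_ne (Ne.symm hbc), smul_eq_mul, mul_one, mul_zero, add_zero, zero_add,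
      map_one, map_zero] at eb ec
    have u0 := h3 b c l hlt (mem_of_toDual_C_eq_zero ec)
    have u1 := sub_eq_zero.1 (h4 b c l hlt (mem_of_toDual_C_eq_one eb))
    apply h.eq_one_of_map_eq_one
    rw [map_pow, map_mul, h.simple, h.simple]
    refine reflMat_mul_pow_eq_one hs (κ := C (κ b c)) ?_ ?_ ?_
      (four_sub_C_sq_ne_zero hm (hκ b c)) ?_ ?_
    · rw [toBilin'_single, h.diag]
    · rw [toBilin'_single, h.diag]
    · rw [toBilin'_single, hK]
    · rw [← map_chebU, u0, map_zero]
    · rw [← map_chebU, u1, map_one]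

end Reduction

end GramRep

/-- A finite set of nonzero elements of an order avoids some principal ideal of finite index. -/
theorem exists_ideal_finite_quotient {A : Type*} [CommRing A] [IsDomain A] [CharZero A]
    [Module.Finite ℤ A] (S : Finset A) :
    ∃ I : Ideal A, Finite (A ⧸ I) ∧ ∀ e ∈ S, e ∈ I → e = 0 := by
  let v := Module.Free.chooseBasis ℤ A
  let s : ℕ := 1 + ∑ e ∈ S, ∑ i, (v.repr e i).natAbs
  have hs : (s : A) ≠ 0 := Nat.cast_ne_zero.2 (by omega)
  refine ⟨Ideal.span {(s : A)},
    Ideal.finiteQuotientOfFreeOfNeBot _ (by simpa [Ideal.span_singleton_eq_bot] using hs),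
    fun e he hes => ?_⟩
  obtain ⟨x, rfl⟩ := Ideal.mem_span_singleton.1 hes
  have hsum : ∀ i, (v.repr (s * x) i).natAbs < s := by
    intro i
    have h1 := Finset.single_le_sum (f := fun i => (v.repr (s * x) i).natAbs)
      (fun _ _ => Nat.zero_le _) (Finset.mem_univ i)
    have h2 := Finset.single_le_sum (f := fun e => ∑ i, (v.repr e i).natAbs)
      (fun _ _ => Nat.zero_le _) he
    beta_reduce at h1 h2
    omega
  apply v.repr.injective
  ext i
  have h3 : v.repr (s * x) i = s * v.repr x i := by
    rw [← nsmul_eq_mul, map_nsmul, Finsupp.smul_apply, nsmul_eq_mul]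
  have h4 := hsum i
  rw [h3, Int.natAbs_mul, Int.natAbs_natCast] at h4
  have h5 : (v.repr x i).natAbs = 0 := by
    by_contra h5
    exact absurd h4 (not_lt.2 (Nat.le_mul_of_pos_right _ (Nat.pos_of_ne_zero h5)))
  rw [h3, Int.natAbs_eq_zero.1 h5, mul_zero, map_zero, Finsupp.zero_apply]

theorem finiteIndex_ker_of_finite {G H : Type*} [Group G] [Monoid H] [Finite H] (f : G →* H) :
    f.ker.FiniteIndex := by
  have : f.ker = f.toHomUnits.ker := by
    ext x
    rw [MonoidHom.mem_ker, MonoidHom.mem_ker, Units.ext_iff]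
    rfl
  rw [this]
  exact Subgroup.finiteIndex_ker _

/-- Every Coxeter group on a finite generating set is virtually RFRS: it has a
finite-index subgroup that is RFRS. -/
theorem coxeterGroup_virtually_RFRS {B : Type*} [Finite B] (M : CoxeterMatrix B) :
    ∃ G' : Subgroup M.Group, G'.FiniteIndex ∧ IsRFRS G' := by
  classical
  have := Fintype.ofFinite B
  let x : B × B → ℝ := fun p => 2 * Real.cos (Real.pi / M p.1 p.2)
  let A := Algebra.adjoin ℤ (Set.range x)
  have hfin : Module.Finite ℤ A := by
    refine Algebra.finite_adjoin_of_finite_of_isIntegral (Set.finite_range x) ?_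
    rintro _ ⟨p, rfl⟩
    have e : x p = 2 * Real.cos (((1 / M p.1 p.2 : ℚ) : ℝ) * Real.pi) := by
      simp only [x]
      push_cast
      rw [one_div_mul_eq_div]
    rw [e]
    exact Real.isIntegral_two_mul_cos_rat_mul_pi _
  let κ : B → B → A := fun b c => ⟨x (b, c), Algebra.subset_adjoin ⟨_, rfl⟩⟩
  let θ : A →+* ℝ := A.val.toRingHom
  have hθ : Function.Injective θ := Subtype.val_injective
  have hκ : ∀ b c, θ (κ b c) = 2 * Real.cos (Real.pi / M b c) := fun b c => rfl
  let S : Finset A := {1, 2} ∪ Finset.univ.biUnion fun p : B × B =>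
    (Finset.range (M p.1 p.2)).image (fun k => chebU (κ p.1 p.2) (2 * k)) ∪
      (Finset.range (M p.1 p.2)).image (fun k => chebU (κ p.1 p.2) (2 * k + 1) - 1)
  obtain ⟨I, hI, hS⟩ := exists_ideal_finite_quotient S
  let cs := M.toCoxeterSystem
  have : Finite (DualNumber (A ⧸ I)) := inferInstanceAs (Finite ((A ⧸ I) × (A ⧸ I)))
  have : Finite (Matrix B B (DualNumber (A ⧸ I))) :=
    inferInstanceAs (Finite (B → B → DualNumber (A ⧸ I)))
  let f : M.Group →* Matrix B B (DualNumber (A ⧸ I)) :=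
    (GramRep.toDual I).mapMatrix.toMonoidHom.comp (GramRep.geomRep cs hθ hκ)
  have : f.ker.FiniteIndex := finiteIndex_ker_of_finite f
  have : cs.lengthParity.ker.FiniteIndex := by
    have : Finite (Multiplicative (ZMod 2)) := inferInstanceAs (Finite (ZMod 2))
    exact Subgroup.finiteIndex_ker _
  let N := f.ker ⊓ cs.lengthParity.ker
  refine ⟨N, inferInstance, ?_⟩
  let := GramRep.vecAction (GramRep.geomRep cs hθ hκ)
  refine (GramRep.isGood hθ hκ (I := I) (N := N) (fun n hn => hn.1) inf_le_right
    (fun h => one_ne_zero (hS 1 (by simp [S]) h)) (fun h => two_ne_zero (hS 2 (by simp [S]) h))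
    (fun b c k hk => hS _ ?_) (fun b c k hk => hS _ ?_)).isRFRS
  · refine Finset.mem_union_right _ (Finset.mem_biUnion.2 ⟨(b, c), Finset.mem_univ _, ?_⟩)
    exact Finset.mem_union_left _ (Finset.mem_image.2 ⟨k, Finset.mem_range.2 hk, rfl⟩)
  · refine Finset.mem_union_right _ (Finset.mem_biUnion.2 ⟨(b, c), Finset.mem_univ _, ?_⟩)
    exact Finset.mem_union_right _ (Finset.mem_image.2 ⟨k, Finset.mem_range.2 hk, rfl⟩)
end

section
/- If G and H are RFRS groups, then the free product G ∗ H is RFRS. -/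
open Monoid.Coprod

lemma map_mem_ratDer {G H : Type*} [Group G] [Group H] (f : G →* H) {K : Subgroup G}
    {L : Subgroup H} (h : K ≤ L.comap f) {x : G} (hx : x ∈ ratDer K) : f x ∈ ratDer L := by
  obtain ⟨hxK, k, hk, hxk⟩ := hx
  refine ⟨h hxK, k, hk, ?_⟩
  rw [← map_zpow]
  have h1 := Subgroup.mem_map_of_mem f hxk
  rw [Subgroup.map_commutator] at h1
  exact Subgroup.commutator_mono (Subgroup.map_le_iff_le_comap.2 h)
    (Subgroup.map_le_iff_le_comap.2 h) h1

section Wreath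

variable {G H D E : Type*} [Group G] [Group H] [CommGroup D] [CommGroup E]
  (K : Subgroup (Monoid.Coprod G H)) [K.Normal]

/-- The homomorphism from `G ∗ H` to the wreath product `D ≀ᵣ (G ∗ H) ⧸ K` which is the quotient map
on `G`, and on `H` is the quotient map conjugated by the function supported at `1` with
value `d`. -/
noncomputable def wreathHom (d : D) :
    Monoid.Coprod G H →* RegularWreathProduct D (Monoid.Coprod G H ⧸ K) := by
  classical
  exact lift (RegularWreathProduct.inl.comp ((QuotientGroup.mk' K).comp inl))
    ((MulAut.conj ⟨Pi.mulSingle 1 d, 1⟩).toMonoidHom.comp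
      (RegularWreathProduct.inl.comp ((QuotientGroup.mk' K).comp inr)))

lemma wreathHom_right (d : D) (x : Monoid.Coprod G H) : (wreathHom K d x).right = x := by
  have : RegularWreathProduct.rightHom.comp (wreathHom K d) = QuotientGroup.mk' K := by
    refine hom_ext ?_ ?_ <;> ext x <;> simp [wreathHom]
  exact DFunLike.congr_fun this x

lemma wreathHom_inl_left (d : D) (g : G) : (wreathHom K d (inl g)).left = 1 := by
  simp [wreathHom]

lemma wreathHom_inr_left (d : D) (h : H) (q : Monoid.Coprod G H ⧸ K)
    [DecidableEq (Monoid.Coprod G H ⧸ K)] :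
    (wreathHom K d (inr h)).left q =
      (if q = 1 then d else 1) * (if q = (inr h : Monoid.Coprod G H) then d else 1)⁻¹ := by
  simp only [wreathHom, lift_apply_inr]
  simp [Pi.mulSingle_apply, inv_mul_eq_one, eq_comm (a := q)]

lemma wreathHom_mul_left (d : D) (x y : Monoid.Coprod G H) (q : Monoid.Coprod G H ⧸ K) :
    (wreathHom K d (x * y)).left q =
      (wreathHom K d x).left q * (wreathHom K d y).left ((x : Monoid.Coprod G H ⧸ K)⁻¹ * q) := by
  simp [wreathHom_right]

lemma wreathHom_map_left (f : D →* E) (d : D) (x : Monoid.Coprod G H) :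
    ∀ q, (wreathHom K (f d) x).left q = f ((wreathHom K d x).left q) := by
  classical
  induction x using induction_on with
  | inl g => simp [wreathHom_inl_left]
  | inr h =>
    intro q
    rw [wreathHom_inr_left, wreathHom_inr_left]
    split_ifs <;> simp
  | mul x y hx hy =>
    intro q
    rw [wreathHom_mul_left, wreathHom_mul_left, hx, hy, map_mul]

/-- The kernel of `wreathHom` with coefficients in `ℤ/2`. -/
noncomputable def wreathKer : Subgroup (Monoid.Coprod G H) :=
  (wreathHom K (Multiplicative.ofAdd (1 : ZMod 2))).ker

instance : (wreathKer K).Normal := inferInstanceAs (MonoidHom.ker _).Normal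

instance [K.FiniteIndex] : (wreathKer K).FiniteIndex := by
  have : Finite (Multiplicative (ZMod 2)) := inferInstanceAs (Finite (ZMod 2))
  exact Subgroup.finiteIndex_ker _

lemma wreathKer_le : wreathKer K ≤ K := fun x hx ↦ by
  rw [← QuotientGroup.eq_one_iff, ← wreathHom_right K (Multiplicative.ofAdd (1 : ZMod 2)),
    MonoidHom.mem_ker.1 hx, RegularWreathProduct.one_right]

/-- The restriction of `wreathHom` to `K`, as a homomorphism to the base of the wreath product. -/
noncomputable def wreathHomRestrict (d : D) : K →* (Monoid.Coprod G H ⧸ K → D) where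
  toFun x := (wreathHom K d x).left
  map_one' := by simp
  map_mul' x y := by
    ext q
    rw [Subgroup.coe_mul, wreathHom_mul_left, (QuotientGroup.eq_one_iff _).2 x.2]
    simp

lemma wreathHom_left_of_mem_commutator (d : D) {x : Monoid.Coprod G H} (hx : x ∈ ⁅K, K⁆) :
    (wreathHom K d x).left = 1 := by
  rw [← Subgroup.map_subtype_commutator] at hx
  obtain ⟨y, hy, rfl⟩ := hx
  exact Abelianization.commutator_subset_ker (wreathHomRestrict K d) hy

lemma ratDer_subset_wreathKer : ratDer K ⊆ (wreathKer K : Set (Monoid.Coprod G H)) := by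
  rintro x ⟨hx, k, hk, hxk⟩
  have h : wreathHomRestrict K (Multiplicative.ofAdd (1 : ℤ)) ⟨x, hx⟩ = 1 := by
    have h1 : wreathHomRestrict K (Multiplicative.ofAdd (1 : ℤ)) ⟨x, hx⟩ ^ k = 1 := by
      rw [← map_zpow]
      exact wreathHom_left_of_mem_commutator K _ hxk
    ext q
    have h2 := congrArg Multiplicative.toAdd (congrFun h1 q)
    simpa [hk] using h2
  rw [SetLike.mem_coe, wreathKer, MonoidHom.mem_ker]
  ext q
  · have := wreathHom_map_left K (AddMonoidHom.toMultiplicative (Int.castAddHom (ZMod 2)))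
      (Multiplicative.ofAdd (1 : ℤ)) x q
    rw [show (wreathHom K (Multiplicative.ofAdd (1 : ℤ)) x).left q = 1 from congrFun h q] at this
    simpa using this
  · rw [wreathHom_right, (QuotientGroup.eq_one_iff _).2 hx, RegularWreathProduct.one_right]

end Wreath

section Words

variable {G H : Type*} [Group G] [Group H]

/-- The element of `G ∗ H` spelled by a word in `G ⊕ H`. -/
def wordProd (l : List (G ⊕ H)) : Monoid.Coprod G H := (l.map (Sum.elim inl inr)).prod

@[simp] lemma wordProd_nil : wordProd ([] : List (G ⊕ H)) = 1 := rfl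

@[simp] lemma wordProd_cons (s : G ⊕ H) (l : List (G ⊕ H)) :
    wordProd (s :: l) = Sum.elim inl inr s * wordProd l := by
  simp [wordProd]

@[simp] lemma wordProd_append (l m : List (G ⊕ H)) :
    wordProd (l ++ m) = wordProd l * wordProd m := by
  simp [wordProd]

lemma wordProd_surjective (x : Monoid.Coprod G H) : ∃ l, wordProd l = x := by
  induction x using induction_on with
  | inl g => exact ⟨[.inl g], by simp⟩
  | inr h => exact ⟨[.inr h], by simp⟩
  | mul x y hx hy =>
    obtain ⟨l, rfl⟩ := hx
    obtain ⟨m, rfl⟩ := hy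
    exact ⟨l ++ m, by simp⟩

/-- Every element of `G ∗ H` is spelled by a word whose letters are nontrivial and alternate between
`G` and `H`. -/
lemma exists_reduced_word (x : Monoid.Coprod G H) : ∃ l : List (G ⊕ H), wordProd l = x ∧
    (∀ s ∈ l, (Sum.elim inl inr s : Monoid.Coprod G H) ≠ 1) ∧
    l.IsChain fun s t ↦ s.isLeft ≠ t.isLeft := by
  classical
  have hex : ∃ n, ∃ l : List (G ⊕ H), wordProd l = x ∧ l.length = n :=
    let ⟨l, hl⟩ := wordProd_surjective x
    ⟨_, l, hl, rfl⟩
  obtain ⟨l, hl, hn⟩ := Nat.find_spec hex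
  have hmin (m : List (G ⊕ H)) (hm : wordProd m = x) : l.length ≤ m.length :=
    hn ▸ Nat.find_min' hex ⟨m, hm, rfl⟩
  refine ⟨l, hl, fun s hs h ↦ ?_, List.isChain_iff_forall_rel_of_append_cons_cons.2 ?_⟩
  · obtain ⟨a, b, rfl⟩ := List.append_of_mem hs
    have := hmin (a ++ b) (by simpa [h] using hl)
    simp at this
  · intro s t a b hab h
    subst hab
    obtain ⟨u, hu⟩ : ∃ u : G ⊕ H, (Sum.elim inl inr u : Monoid.Coprod G H) =
        Sum.elim inl inr s * Sum.elim inl inr t := by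
      rcases s with s | s <;> rcases t with t | t
      · exact ⟨.inl (s * t), by simp⟩
      · simp at h
      · simp at h
      · exact ⟨.inr (s * t), by simp⟩
    have := hmin (a ++ u :: b) (by simpa [hu, mul_assoc] using hl)
    simp at this

lemma wreathHom_letter_left_eq_one {D : Type*} [CommGroup D] (K : Subgroup (Monoid.Coprod G H))
    [K.Normal] (d : D) (s : G ⊕ H) (q : Monoid.Coprod G H ⧸ K) (h1 : q ≠ 1)
    (hs : q ≠ (Sum.elim inl inr s : Monoid.Coprod G H)) :
    (wreathHom K d (Sum.elim inl inr s)).left q = 1 := by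
  classical
  rcases s with g | h
  · simp [wreathHom_inl_left]
  · rw [Sum.elim_inr] at hs ⊢
    simp [wreathHom_inr_left, h1, hs]

lemma wreathHom_wordProd_left_eq_one {D : Type*} [CommGroup D] (K : Subgroup (Monoid.Coprod G H))
    [K.Normal] (d : D) (l : List (G ⊕ H)) (q : Monoid.Coprod G H ⧸ K)
    (h : ∀ m, m <+: l → q ≠ (wordProd m : Monoid.Coprod G H)) :
    (wreathHom K d (wordProd l)).left q = 1 := by
  induction l generalizing q with
  | nil => simp
  | cons s l ih =>
    rw [wordProd_cons, wreathHom_mul_left, ih, mul_one]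
    · refine wreathHom_letter_left_eq_one K d s q ?_ ?_
      · simpa using h [] (by simp)
      · simpa using h [s] (by simp)
    · intro m hm hq
      refine h (s :: m) (by simpa using hm) ?_
      rw [wordProd_cons, QuotientGroup.mk_mul, ← hq, mul_inv_cancel_left]

/-- If no nonempty proper subword of a reduced word of length at least two lies in `K`, then
the word itself does not lie in `wreathKer K`. -/
lemma wordProd_notMem_wreathKer (K : Subgroup (Monoid.Coprod G H)) [K.Normal]
    (s t : G ⊕ H) (l : List (G ⊕ H)) (hst : s.isLeft ≠ t.isLeft)
    (hs : (Sum.elim inl inr s : Monoid.Coprod G H) ∉ K)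
    (h : ∀ m, m <+: l → wordProd (t :: m) ∉ K) :
    wordProd (s :: t :: l) ∉ wreathKer K := by
  classical
  intro hmem
  have hd : Multiplicative.ofAdd (1 : ZMod 2) ≠ 1 := by decide
  rw [wreathKer, MonoidHom.mem_ker] at hmem
  generalize Multiplicative.ofAdd (1 : ZMod 2) = d at hd hmem
  have hs1 : ((Sum.elim inl inr s : Monoid.Coprod G H) : Monoid.Coprod G H ⧸ K) ≠ 1 :=
    mt (QuotientGroup.eq_one_iff _).1 hs
  have ht1 : (1 : Monoid.Coprod G H ⧸ K) ≠ (Sum.elim inl inr t : Monoid.Coprod G H) :=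
    fun h1 ↦ h [] (by simp) (by simpa using (QuotientGroup.eq_one_iff _).1 h1.symm)
  have hl : (wreathHom K d (wordProd l)).left
      ((Sum.elim inl inr t : Monoid.Coprod G H) : Monoid.Coprod G H ⧸ K)⁻¹ = 1 := by
    refine wreathHom_wordProd_left_eq_one K d l _ fun m hm hq ↦ h m hm ?_
    rw [← QuotientGroup.eq_one_iff, wordProd_cons, QuotientGroup.mk_mul, ← hq, mul_inv_cancel]
  have key := congrFun (congrArg RegularWreathProduct.left hmem)
    ((Sum.elim inl inr s : Monoid.Coprod G H) : Monoid.Coprod G H ⧸ K)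
  rw [wordProd_cons, wordProd_cons, wreathHom_mul_left, wreathHom_mul_left, inv_mul_cancel,
    mul_one, hl, mul_one] at key
  rcases s with s | s <;> rcases t with t | t
  · simp at hst
  · simp only [Sum.elim_inl, Sum.elim_inr] at key ht1
    simp [wreathHom_inl_left, wreathHom_inr_left, ht1, hd] at key
  · simp only [Sum.elim_inl, Sum.elim_inr] at key hs1
    simp [wreathHom_inl_left, wreathHom_inr_left, hs1, hd] at key
  · simp at hst

end Words

section Tower

variable {G H : Type*} [Group G] [Group H]

/-- The subgroups of `G ∗ H` obtained from a sequence of normal subgroups `S` by alternately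
applying `wreathKer` and intersecting with the next term of `S`. -/
noncomputable def wreathTower (S : ℕ → {K : Subgroup (Monoid.Coprod G H) // K.Normal}) :
    ℕ → {K : Subgroup (Monoid.Coprod G H) // K.Normal}
  | 0 => S 0
  | n + 1 =>
    have := (wreathTower S n).2
    have := (S (n + 1)).2
    ⟨wreathKer (wreathTower S n).1 ⊓ (S (n + 1)).1, inferInstance⟩

variable (S : ℕ → {K : Subgroup (Monoid.Coprod G H) // K.Normal})

instance (n : ℕ) : (wreathTower S n).1.Normal := (wreathTower S n).2

lemma wreathTower_succ (n : ℕ) : (wreathTower S (n + 1)).1 =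
    wreathKer (wreathTower S n).1 ⊓ (S (n + 1)).1 := rfl

lemma wreathTower_le (n : ℕ) : (wreathTower S n).1 ≤ (S n).1 := by
  cases n with
  | zero => exact le_rfl
  | succ n => exact inf_le_right

lemma wreathTower_antitone : Antitone fun n ↦ (wreathTower S n).1 :=
  antitone_nat_of_succ_le fun _ ↦ inf_le_left.trans (wreathKer_le _)

lemma finiteIndex_wreathTower (hS : ∀ n, (S n).1.FiniteIndex) (n : ℕ) :
    (wreathTower S n).1.FiniteIndex := by
  induction n with
  | zero => exact hS 0
  | succ n ih =>
    rw [wreathTower_succ]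
    have := hS (n + 1)
    infer_instance

lemma wordProd_notMem_wreathTower (n i : ℕ) (l : List (G ⊕ H)) (hl0 : l ≠ [])
    (hl : l.length ≤ i + 1)
    (hn : ∀ s ∈ l, (Sum.elim inl inr s : Monoid.Coprod G H) ∉ (S n).1)
    (hc : l.IsChain fun s t ↦ s.isLeft ≠ t.isLeft) :
    wordProd l ∉ (wreathTower S (n + i)).1 := by
  induction i generalizing l with
  | zero =>
    match l, hl0, hl with
    | [s], _, _ => exact fun h ↦ hn s (by simp) (by simpa using wreathTower_le S n h)
  | succ i ih =>
    match l, hl0, hl with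
    | [s], _, _ =>
      exact fun h ↦ ih [s] (by simp) (by simp) hn hc
        (wreathTower_antitone S (Nat.le_succ (n + i)) h)
    | s :: t :: l, _, hl =>
      rw [List.isChain_cons_cons] at hc
      refine fun h ↦ wordProd_notMem_wreathKer (wreathTower S (n + i)).1 s t l hc.1 ?_ ?_ h.1
      · simpa using ih [s] (by simp) (by simp) (fun u hu ↦ hn u (by simp_all)) (by simp)
      · intro m hm
        have hm' : t :: m <+: t :: l := by simpa using hm
        have := hm.length_le
        have hchain : (t :: m).IsChain fun s t ↦ s.isLeft ≠ t.isLeft := by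
          obtain ⟨k, hk⟩ := hm'
          exact (hk ▸ hc.2).left_of_append
        refine ih (t :: m) (by simp) ?_ (fun u hu ↦ hn u ?_) hchain
        · simp at hl ⊢
          omega
        · exact List.mem_cons_of_mem _ (hm'.subset hu)

end Tower

/-- If `G` and `H` are RFRS groups, then the free product `G ∗ H` is RFRS. -/
theorem isRFRS_freeProduct {G H : Type*} [Group G] [Group H]
    (hG : IsRFRS G) (hH : IsRFRS H) : IsRFRS (Monoid.Coprod G H) := by
  obtain ⟨A, hA0, hAn, hAf, hAl, hAi, hAr⟩ := hG
  obtain ⟨B, hB0, hBn, hBf, hBl, hBi, hBr⟩ := hH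
  have hA : Antitone A := antitone_nat_of_succ_le hAl
  have hB : Antitone B := antitone_nat_of_succ_le hBl
  let S (n : ℕ) : {K : Subgroup (Monoid.Coprod G H) // K.Normal} :=
    ⟨(A n).comap fst ⊓ (B n).comap snd, by
      have := hAn n
      have := hBn n
      infer_instance⟩
  have hSA : Antitone fun n ↦ (S n).1 := fun m n h ↦
    inf_le_inf (Subgroup.comap_mono (hA h)) (Subgroup.comap_mono (hB h))
  refine ⟨fun n ↦ (wreathTower S n).1, ?_, fun n ↦ (wreathTower S n).2,
    finiteIndex_wreathTower S fun n ↦ ?_, fun n ↦ wreathTower_antitone S n.le_succ, ?_, ?_⟩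
  · simp [wreathTower, S, hA0, hB0]
  · refine ⟨Subgroup.index_inf_ne_zero ?_ ?_⟩
    · rw [Subgroup.index_comap_of_surjective _ fst_surjective]
      exact (hAf n).index_ne_zero
    · rw [Subgroup.index_comap_of_surjective _ snd_surjective]
      exact (hBf n).index_ne_zero
  · rw [eq_bot_iff]
    intro x hx
    obtain ⟨l, rfl, hl1, hlc⟩ := exists_reduced_word x
    have hsep (s : G ⊕ H) (hs : s ∈ l) :
        ∃ n, (Sum.elim inl inr s : Monoid.Coprod G H) ∉ (S n).1 := by
      by_contra! h
      refine hl1 s hs ?_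
      rcases s with g | g
      · have : g ∈ ⨅ n, A n := Subgroup.mem_iInf.2 fun n ↦ by simpa using (h n).1
        simp_all
      · have : g ∈ ⨅ n, B n := Subgroup.mem_iInf.2 fun n ↦ by simpa using (h n).2
        simp_all
    have hsep' : ∃ n, ∀ s ∈ l, (Sum.elim inl inr s : Monoid.Coprod G H) ∉ (S n).1 := by
      choose! f hf using hsep
      classical
      exact ⟨l.toFinset.sup f, fun s hs h ↦
        hf s hs (hSA (Finset.le_sup (f := f) (List.mem_toFinset.2 hs)) h)⟩
    obtain ⟨n, hn⟩ := hsep'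
    by_contra hne
    refine wordProd_notMem_wreathTower S n l.length l ?_ (Nat.le_succ _) hn hlc
      (Subgroup.mem_iInf.1 hx _)
    rintro rfl
    exact hne (one_mem _)
  · rintro n x hx
    refine ⟨ratDer_subset_wreathKer _ hx, hAr n ?_, hBr n ?_⟩
    · exact map_mem_ratDer fst ((wreathTower_le S n).trans inf_le_left) hx
    · exact map_mem_ratDer snd ((wreathTower_le S n).trans inf_le_right) hx
end
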